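/- Let n be a positive integer, H = ℚ(ζ_n + ζ_n⁻¹), and ℓ an odd prime with q ≡ 1 (mod ℓ) for some prime factor q of n. Assume there exists a real quadratic subfield K_2 ⊆ H with the ℓ-class number of H equal to ℓ^m and the ℓ-class number of K_2 equal to ℓ^{m-1}, and that for every pair of subfields F ⊆ K of H with K_2 ⊆ F, [K:F] = ℓ, ℓ-class number of F equal to ℓ^{m-1} and of K equal to ℓ^m, the ℓ-part of ker(t_{F→K}) is trivial or isomorphic to (ℤ/ℓℤ)^r for some positive integer r. Let K_2' be any real quadratic subfield of H such that ℓ divides the class number of K_2', let ℓ^i exactly divide [H:ℚ], and let K'_{2ℓ^i} be a subfield of H with K_2' ⊆ K'_{2ℓ^i} and [K'_{2ℓ^i}:K_2'] = ℓ^i. If the ℓ-rank of the class group of K_2 is 1, and it is not the case that (C(H)_ℓ is non-cyclic and the ℓ-class number of K'_{2ℓ^i} equals ℓ^m), then the ℓ-rank of the class group of K_2' is also 1. -/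

import Mathlib

open NumberField IntermediateField Module
open scoped nonZeroDivisors

noncomputable section

namespace PaperStmt

/-- `ζ_n = exp(2πi/n)`, a primitive `n`-th root of unity (for `n > 0`). -/
def zetaC (n : ℕ) : ℂ := Complex.exp (2 * (Real.pi : ℂ) * Complex.I / n)

/-- The maximal real subfield `ℚ(ζ_n + ζ_n⁻¹)` of the cyclotomic field `ℚ(ζ_n)`. -/
def realCyclo (n : ℕ) : IntermediateField ℚ ℂ := ℚ⟮zetaC n + (zetaC n)⁻¹⟯

lemma isIntegral_of_pow_eq_one {x : ℂ} {k : ℕ} (hk : k ≠ 0) (h : x ^ k = 1) :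
    IsIntegral ℚ x :=
  ⟨Polynomial.X ^ k - Polynomial.C 1, Polynomial.monic_X_pow_sub_C 1 hk, by
    simp [h]⟩

lemma zetaC_pow (n : ℕ) (hn : n ≠ 0) : zetaC n ^ n = 1 := by
  have hn' : (n : ℂ) ≠ 0 := Nat.cast_ne_zero.mpr hn
  rw [zetaC, ← Complex.exp_nat_mul, mul_comm ((n : ℂ)), div_mul_cancel₀ _ hn',
    Complex.exp_two_pi_mul_I]

lemma isIntegral_zetaC_add_inv (n : ℕ) : IsIntegral ℚ (zetaC n + (zetaC n)⁻¹) := by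
  rcases eq_or_ne n 0 with h | h
  · have h1 : zetaC 0 = 1 := by simp [zetaC]
    subst h
    rw [h1, inv_one]
    exact isIntegral_one.add isIntegral_one
  · exact (isIntegral_of_pow_eq_one h (zetaC_pow n h)).add
      (isIntegral_of_pow_eq_one h (by rw [inv_pow, zetaC_pow n h, inv_one]))

instance (n : ℕ) : FiniteDimensional ℚ (realCyclo n) :=
  IntermediateField.adjoin.finiteDimensional (isIntegral_zetaC_add_inv n)

instance (E : IntermediateField ℚ ℂ) [FiniteDimensional ℚ E] : NumberField E := ⟨⟩

/-- The `p`-part (`p`-primary component / `p`-Sylow subgroup) of a commutative group. -/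
def pPart (G : Type*) [CommGroup G] (p : ℕ) (hp : p.Prime) : Subgroup G :=
  haveI : Fact p.Prime := ⟨hp⟩
  CommGroup.primaryComponent G p

/-- The `p`-class number: the order of the `p`-part. -/
def pCard (G : Type*) [CommGroup G] (p : ℕ) (hp : p.Prime) : ℕ :=
  Nat.card (pPart G p hp)

/-- The `p`-rank: `dim_{F_p} (G_p / G_p^p)`, read off as the exponent of `p`
in the order of the elementary abelian group `G_p / G_p^p`. -/
def pRank (G : Type*) [CommGroup G] (p : ℕ) (hp : p.Prime) : ℕ :=
  (Nat.card
    (↥(pPart G p hp) ⧸ (powMonoidHom p : ↥(pPart G p hp) →* ↥(pPart G p hp)).range)).factorization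
    p

/-- `t` is the homomorphism of class groups induced by extension of ideals along `F ⊆ K`:
it sends the class of a nonzero ideal `I` of `𝓞 F` to the class of `I · 𝓞 K`. -/
def IsClassGroupExtHom {F K : IntermediateField ℚ ℂ} [NumberField F] [NumberField K]
    (hFK : F ≤ K) (t : ClassGroup (𝓞 F) →* ClassGroup (𝓞 K)) : Prop :=
  ∀ (I : (Ideal (𝓞 F))⁰) (J : (Ideal (𝓞 K))⁰),
    Ideal.map (RingOfIntegers.mapRingHom (IntermediateField.inclusion hFK))
        (I : Ideal (𝓞 F)) = (J : Ideal (𝓞 K)) →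
    t (ClassGroup.mk0 I) = ClassGroup.mk0 J

section Kernel

/-- A function on `ℝ × ℝ`, homogeneous of degree `-2 s`, supported where `κ * z.1 * z.2` is
positive. For real embeddings `φ₁, φ₂` of a quadratic field and a unit `ε` with `A = φ₁ ε ^ 4`,
summing it over the translates of `(φ₁ α, φ₂ α)` by powers of `ε` gives a multiple of
`|N α| ^ (-s)`. -/
noncomputable def kern (A κ s : ℝ) (z : ℝ × ℝ) : ℝ :=
  max (κ * (z.1 * z.2)) 0 ^ (4 - s) / ((z.1 ^ 4 + z.2 ^ 4) * (A * z.1 ^ 4 + A⁻¹ * z.2 ^ 4))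

lemma abs_rpow_sub_rpow_le {p a b M : ℝ} (hp : 1 ≤ p) (ha : 0 ≤ a) (hb : 0 ≤ b)
    (haM : a ≤ M) (hbM : b ≤ M) : |a ^ p - b ^ p| ≤ p * M ^ (p - 1) * |a - b| := by
  have := (convex_Icc (0 : ℝ) M).norm_image_sub_le_of_norm_hasDerivWithin_le
    (f := fun x : ℝ => x ^ p) (f' := fun x => p * x ^ (p - 1)) (C := p * M ^ (p - 1))
    (fun x hx => (Real.hasDerivAt_rpow_const (Or.inr hp)).hasDerivWithinAt)
    (fun x hx => by
      rw [Real.norm_eq_abs, abs_of_nonneg (mul_nonneg (by linarith) (Real.rpow_nonneg hx.1 _))]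
      gcongr
      · exact hx.1
      · exact hx.2)
    (x := b) (y := a) ⟨hb, hbM⟩ ⟨ha, haM⟩
  simpa using this

lemma abs_fst_le (z : ℝ × ℝ) : |z.1| ≤ ‖z‖ := norm_fst_le z
lemma abs_snd_le (z : ℝ × ℝ) : |z.2| ≤ ‖z‖ := norm_snd_le z

lemma pow_four_le (z : ℝ × ℝ) : z.1 ^ 4 ≤ ‖z‖ ^ 4 ∧ z.2 ^ 4 ≤ ‖z‖ ^ 4 := by
  constructor
  · rw [← Even.pow_abs (by decide : Even 4)]; gcongr; exact abs_fst_le z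
  · rw [← Even.pow_abs (by decide : Even 4)]; gcongr; exact abs_snd_le z

lemma norm_pow_four_le (z : ℝ × ℝ) : ‖z‖ ^ 4 ≤ z.1 ^ 4 + z.2 ^ 4 := by
  have h1 : 0 ≤ z.1 ^ 4 := by positivity
  have h2 : 0 ≤ z.2 ^ 4 := by positivity
  rcases max_choice ‖z.1‖ ‖z.2‖ with h | h
  · rw [Prod.norm_def, h, Real.norm_eq_abs, Even.pow_abs (by decide : Even 4)]; linarith
  · rw [Prod.norm_def, h, Real.norm_eq_abs, Even.pow_abs (by decide : Even 4)]; linarith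

/-- The denominator of `kern`. -/
noncomputable def kernDen (A : ℝ) (z : ℝ × ℝ) : ℝ :=
  (z.1 ^ 4 + z.2 ^ 4) * (A * z.1 ^ 4 + A⁻¹ * z.2 ^ 4)

variable {A κ : ℝ}

lemma kernDen_ge (hA : 0 < A) (hA1 : A < 1) (z : ℝ × ℝ) : A * ‖z‖ ^ 8 ≤ kernDen A z := by
  have h := norm_pow_four_le z
  have h1 : 0 ≤ z.1 ^ 4 := by positivity
  have h2 : 0 ≤ z.2 ^ 4 := by positivity
  have hinv : A ≤ A⁻¹ := hA1.le.trans (one_le_inv₀ hA |>.2 hA1.le)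
  have h3 : A * ‖z‖ ^ 4 ≤ A * z.1 ^ 4 + A⁻¹ * z.2 ^ 4 := by nlinarith
  calc A * ‖z‖ ^ 8 = ‖z‖ ^ 4 * (A * ‖z‖ ^ 4) := by ring
    _ ≤ _ := by unfold kernDen; gcongr

lemma max_mul_le (hκ : |κ| = 1) (z : ℝ × ℝ) : max (κ * (z.1 * z.2)) 0 ≤ ‖z‖ ^ 2 := by
  apply max_le _ (by positivity)
  refine (le_abs_self _).trans ?_
  rw [abs_mul, hκ, one_mul, abs_mul, sq]
  gcongr
  · exact abs_fst_le z
  · exact abs_snd_le z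

lemma kern_nonneg (hA : 0 < A) (s : ℝ) (z : ℝ × ℝ) : 0 ≤ kern A κ s z := by
  unfold kern; positivity

lemma kern_le (hA : 0 < A) (hA1 : A < 1) (hκ : |κ| = 1) {s : ℝ} (hs2 : s ≤ 2)
    {z : ℝ × ℝ} (hz : 1 ≤ ‖z‖) : kern A κ s z ≤ A⁻¹ * ‖z‖ ^ (-(2 * s)) := by
  have hz0 : 0 < ‖z‖ := by linarith
  have h1 : max (κ * (z.1 * z.2)) 0 ^ (4 - s) ≤ (‖z‖ ^ 2) ^ (4 - s) :=
    Real.rpow_le_rpow (le_max_right _ _) (max_mul_le hκ z) (by linarith)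
  calc kern A κ s z ≤ (‖z‖ ^ 2) ^ (4 - s) / (A * ‖z‖ ^ 8) := by
        unfold kern
        have := kernDen_ge hA hA1 z
        unfold kernDen at this
        gcongr
    _ = A⁻¹ * ‖z‖ ^ (-(2 * s)) := by
        rw [← Real.rpow_natCast ‖z‖ 2, ← Real.rpow_natCast ‖z‖ 8, ← Real.rpow_mul hz0.le,
          div_eq_mul_inv, mul_inv, ← Real.rpow_neg hz0.le, mul_left_comm, ← Real.rpow_add hz0]
        congr 2; push_cast; ring

lemma kern_zero {s : ℝ} : kern A κ s 0 = 0 := by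
  simp [kern]

lemma kern_le_inv (hA : 0 < A) (hA1 : A < 1) (hκ : |κ| = 1) {s : ℝ} (hs : 0 ≤ s) (hs2 : s ≤ 2)
    {z : ℝ × ℝ} (hz : z = 0 ∨ 1 ≤ ‖z‖) : kern A κ s z ≤ A⁻¹ := by
  rcases hz with rfl | hz
  · rw [kern_zero]; positivity
  · refine (kern_le hA hA1 hκ hs2 hz).trans ?_
    have := Real.rpow_le_one_of_one_le_of_nonpos hz (show -(2 * s) ≤ 0 by linarith)
    have hA' : 0 < A⁻¹ := by positivity
    nlinarith

lemma abs_pow_four_sub_le {x y R : ℝ} (hx : |x| ≤ R) (hy : |y| ≤ R) :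
    |x ^ 4 - y ^ 4| ≤ 4 * R ^ 3 * |x - y| := by
  have hR : 0 ≤ R := (abs_nonneg _).trans hx
  have : x ^ 4 - y ^ 4 = (x ^ 3 + x ^ 2 * y + x * y ^ 2 + y ^ 3) * (x - y) := by ring
  rw [this, abs_mul]
  gcongr
  have h1 : |x ^ 3| ≤ R ^ 3 := by rw [abs_pow]; gcongr
  have h2 : |x ^ 2 * y| ≤ R ^ 3 := by
    rw [abs_mul, abs_pow]; calc _ ≤ R ^ 2 * R := by gcongr
      _ = _ := by ring
  have h3 : |x * y ^ 2| ≤ R ^ 3 := by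
    rw [abs_mul, abs_pow]; calc _ ≤ R * R ^ 2 := by gcongr
      _ = _ := by ring
  have h4 : |y ^ 3| ≤ R ^ 3 := by rw [abs_pow]; gcongr
  calc _ ≤ |x ^ 3| + |x ^ 2 * y| + |x * y ^ 2| + |y ^ 3| := by
        refine (abs_add_le _ _).trans ?_
        gcongr
        exact (abs_add_le _ _).trans (by gcongr; exact abs_add_le _ _)
    _ ≤ _ := by linarith

lemma kernDen_sub_le (hA : 0 < A) (hA1 : A < 1) {z w : ℝ × ℝ} {R : ℝ} (hz : ‖z‖ ≤ R)
    (hw : ‖w‖ ≤ R) : |kernDen A z - kernDen A w| ≤ 32 * A⁻¹ * R ^ 7 * ‖z - w‖ := by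
  have hR : 0 ≤ R := (norm_nonneg _).trans hz
  have hinv : A ≤ A⁻¹ := hA1.le.trans (one_le_inv₀ hA |>.2 hA1.le)
  set δ := ‖z - w‖ with hδ
  have h1 : |z.1 ^ 4 - w.1 ^ 4| ≤ 4 * R ^ 3 * δ :=
    (abs_pow_four_sub_le ((abs_fst_le z).trans hz) ((abs_fst_le w).trans hw)).trans
      (by gcongr; exact abs_fst_le (z - w))
  have h2 : |z.2 ^ 4 - w.2 ^ 4| ≤ 4 * R ^ 3 * δ :=
    (abs_pow_four_sub_le ((abs_snd_le z).trans hz) ((abs_snd_le w).trans hw)).trans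
      (by gcongr; exact abs_snd_le (z - w))
  have hzR : ‖z‖ ^ 4 ≤ R ^ 4 := by gcongr
  have hwR : ‖w‖ ^ 4 ≤ R ^ 4 := by gcongr
  have z1 := (pow_four_le z).1.trans hzR
  have z2 := (pow_four_le z).2.trans hzR
  have w1 := (pow_four_le w).1.trans hwR
  have w2 := (pow_four_le w).2.trans hwR
  have e : kernDen A z - kernDen A w =
      (A * z.1 ^ 4 + A⁻¹ * z.2 ^ 4) * ((z.1 ^ 4 - w.1 ^ 4) + (z.2 ^ 4 - w.2 ^ 4)) +
      (w.1 ^ 4 + w.2 ^ 4) * (A * (z.1 ^ 4 - w.1 ^ 4) + A⁻¹ * (z.2 ^ 4 - w.2 ^ 4)) := by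
    unfold kernDen; ring
  have p1 : 0 ≤ z.1 ^ 4 := by positivity
  have p2 : 0 ≤ z.2 ^ 4 := by positivity
  have p3 : 0 ≤ w.1 ^ 4 := by positivity
  have p4 : 0 ≤ w.2 ^ 4 := by positivity
  have hAi : 0 < A⁻¹ := by positivity
  rw [e]
  calc _ ≤ |A * z.1 ^ 4 + A⁻¹ * z.2 ^ 4| * |(z.1 ^ 4 - w.1 ^ 4) + (z.2 ^ 4 - w.2 ^ 4)| +
      |w.1 ^ 4 + w.2 ^ 4| * |A * (z.1 ^ 4 - w.1 ^ 4) + A⁻¹ * (z.2 ^ 4 - w.2 ^ 4)| := by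
        rw [← abs_mul, ← abs_mul]; exact abs_add_le _ _
    _ ≤ (A⁻¹ * R ^ 4 + A⁻¹ * R ^ 4) * (4 * R ^ 3 * δ + 4 * R ^ 3 * δ) +
      (R ^ 4 + R ^ 4) * (A⁻¹ * (4 * R ^ 3 * δ) + A⁻¹ * (4 * R ^ 3 * δ)) := by
        gcongr
        · rw [abs_of_nonneg (by positivity)]; gcongr
        · exact (abs_add_le _ _).trans (by gcongr)
        · rw [abs_of_nonneg (by positivity)]; gcongr
        · refine (abs_add_le _ _).trans ?_
          rw [abs_mul, abs_mul, abs_of_pos hA, abs_of_pos hAi]; gcongr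
    _ = _ := by ring

lemma abs_max_sub_le (hκ : |κ| = 1) {z w : ℝ × ℝ} {R : ℝ} (hz : ‖z‖ ≤ R) (hw : ‖w‖ ≤ R) :
    |max (κ * (z.1 * z.2)) 0 - max (κ * (w.1 * w.2)) 0| ≤ 2 * R * ‖z - w‖ := by
  have hR : 0 ≤ R := (norm_nonneg _).trans hz
  refine (abs_max_sub_max_le_abs _ _ _).trans ?_
  rw [← mul_sub, abs_mul, hκ, one_mul]
  have : z.1 * z.2 - w.1 * w.2 = z.1 * (z.2 - w.2) + w.2 * (z.1 - w.1) := by ring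
  rw [this]
  refine (abs_add_le _ _).trans ?_
  rw [abs_mul, abs_mul]
  have a1 := (abs_fst_le z).trans hz
  have a2 := (abs_snd_le w).trans hw
  have a3 : |z.2 - w.2| ≤ ‖z - w‖ := abs_snd_le (z - w)
  have a4 : |z.1 - w.1| ≤ ‖z - w‖ := abs_fst_le (z - w)
  calc _ ≤ R * ‖z - w‖ + R * ‖z - w‖ := by gcongr
    _ = _ := by ring

lemma kern_sub_le (hA : 0 < A) (hA1 : A < 1) (hκ : |κ| = 1) {s : ℝ} (hs : 1 ≤ s) (hs2 : s ≤ 2)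
    {z w : ℝ × ℝ} (hz : 1 ≤ ‖z‖) (hw : ‖z‖ ≤ 2 * ‖w‖) (hw' : ‖w‖ ≤ 2 * ‖z‖) :
    |kern A κ s z - kern A κ s w| ≤
      (2 ^ 27 * A⁻¹ ^ 3) * ‖z - w‖ * ‖z‖ ^ (-3 : ℝ) := by
  set ρ := ‖z‖
  set δ := ‖z - w‖
  have hρ : 0 < ρ := by linarith
  have hδ : 0 ≤ δ := norm_nonneg _
  have hAi : 1 ≤ A⁻¹ := (one_le_inv₀ hA).2 hA1.le
  have hX : (4 * ρ ^ 2) ^ (4 - s - 1) ≤ 16 * ρ ^ 4 := by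
    calc _ ≤ (4 * ρ ^ 2) ^ (2 : ℝ) :=
          Real.rpow_le_rpow_of_exponent_le (by nlinarith) (by linarith)
      _ = 16 * ρ ^ 4 := by rw [Real.rpow_two]; ring
  have hY : (4 * ρ ^ 2) ^ (4 - s) ≤ 64 * ρ ^ 6 := by
    calc _ ≤ (4 * ρ ^ 2) ^ (3 : ℝ) :=
          Real.rpow_le_rpow_of_exponent_le (by nlinarith) (by linarith)
      _ = 64 * ρ ^ 6 := by rw [show (3 : ℝ) = (3 : ℕ) by norm_num, Real.rpow_natCast]; ring
  set u := max (κ * (z.1 * z.2)) 0 with hu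
  set v := max (κ * (w.1 * w.2)) 0 with hv
  have hu0 : 0 ≤ u := le_max_right _ _
  have hv0 : 0 ≤ v := le_max_right _ _
  have hu4 : u ≤ 4 * ρ ^ 2 := (max_mul_le hκ z).trans (by nlinarith)
  have hv4 : v ≤ 4 * ρ ^ 2 := (max_mul_le hκ w).trans (by nlinarith [norm_nonneg w])
  have huv : |u - v| ≤ 2 * (2 * ρ) * δ := abs_max_sub_le hκ (by linarith) hw'
  have hf : |u ^ (4 - s) - v ^ (4 - s)| ≤ 192 * ρ ^ 5 * δ := by
    calc _ ≤ (4 - s) * (4 * ρ ^ 2) ^ (4 - s - 1) * |u - v| :=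
          abs_rpow_sub_rpow_le (by linarith) hu0 hv0 hu4 hv4
      _ ≤ 3 * (16 * ρ ^ 4) * (2 * (2 * ρ) * δ) := by gcongr; linarith
      _ = _ := by ring
  have hv6 : v ^ (4 - s) ≤ 64 * ρ ^ 6 :=
    (Real.rpow_le_rpow hv0 hv4 (by linarith)).trans hY
  have hD1 : A * ρ ^ 8 ≤ kernDen A z := kernDen_ge hA hA1 z
  have hD2 : A * (ρ / 2) ^ 8 ≤ kernDen A w :=
    le_trans (by gcongr; linarith) (kernDen_ge hA hA1 w)
  have hDD : |kernDen A w - kernDen A z| ≤ 32 * A⁻¹ * (2 * ρ) ^ 7 * δ := by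
    rw [abs_sub_comm]
    exact kernDen_sub_le hA hA1 (by linarith) hw'
  have hD1p : 0 < kernDen A z := lt_of_lt_of_le (by positivity) hD1
  have hD2p : 0 < kernDen A w := lt_of_lt_of_le (by positivity) hD2
  have e : kern A κ s z - kern A κ s w = (u ^ (4 - s) - v ^ (4 - s)) / kernDen A z +
      v ^ (4 - s) * (kernDen A w - kernDen A z) / (kernDen A z * kernDen A w) := by
    change u ^ (4 - s) / kernDen A z - v ^ (4 - s) / kernDen A w = _
    field_simp
    ring
  rw [e]
  calc _ ≤ |u ^ (4 - s) - v ^ (4 - s)| / kernDen A z +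
      v ^ (4 - s) * |kernDen A w - kernDen A z| / (kernDen A z * kernDen A w) := by
        refine (abs_add_le _ _).trans ?_
        rw [abs_div, abs_of_pos hD1p, abs_div, abs_mul, abs_of_nonneg (Real.rpow_nonneg hv0 _),
          abs_of_pos (mul_pos hD1p hD2p)]
    _ ≤ (192 * ρ ^ 5 * δ) / (A * ρ ^ 8) +
      (64 * ρ ^ 6) * (32 * A⁻¹ * (2 * ρ) ^ 7 * δ) / ((A * ρ ^ 8) * (A * (ρ / 2) ^ 8)) := by
        gcongr
    _ = (192 * A⁻¹ + 2 ^ 26 * A⁻¹ ^ 3) * δ * (ρ ^ 3)⁻¹ := by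
        field_simp
        ring
    _ ≤ (2 ^ 27 * A⁻¹ ^ 3) * δ * (ρ ^ 3)⁻¹ := by
        gcongr
        nlinarith [pow_le_pow_left₀ zero_le_one hAi 2]
    _ = _ := by
        rw [Real.rpow_neg hρ.le, show (3 : ℝ) = (3 : ℕ) by norm_num, Real.rpow_natCast]

lemma exists_kern_sub_le (hA : 0 < A) (hA1 : A < 1) (hκ : |κ| = 1) (r : ℝ × ℝ) :
    ∃ C : ℝ, ∀ s : ℝ, 1 ≤ s → s ≤ 2 → ∀ z : ℝ × ℝ, (z = 0 ∨ 1 ≤ ‖z‖) →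
      (z + r = 0 ∨ 1 ≤ ‖z + r‖) →
      |kern A κ s z - kern A κ s (z + r)| ≤ C * (1 + ‖z‖) ^ (-3 : ℝ) := by
  refine ⟨A⁻¹ * (1 + 2 * ‖r‖) ^ (3 : ℝ) + 2 ^ 27 * A⁻¹ ^ 3 * ‖r‖ * 2 ^ (3 : ℝ),
    fun s hs hs2 z hz hzr => ?_⟩
  have hr0 := norm_nonneg r
  have hz0 := norm_nonneg z
  have key : ∀ M B : ℝ, 0 < M → 0 ≤ B → 1 + ‖z‖ ≤ M →
      B ≤ B * M ^ (3 : ℝ) * (1 + ‖z‖) ^ (-3 : ℝ) := by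
    intro M B hM hB h
    rw [Real.rpow_neg (by linarith), ← div_eq_mul_inv, le_div_iff₀ (by positivity)]
    gcongr
  rw [add_mul]
  rcases le_or_gt ‖z‖ (2 * ‖r‖) with h | h
  · have h1 := kern_le_inv hA hA1 hκ (by linarith) hs2 hz
    have h2 := kern_le_inv hA hA1 hκ (by linarith) hs2 hzr
    have h3 := kern_nonneg (κ := κ) hA s z
    have h4 := kern_nonneg (κ := κ) hA s (z + r)
    have h5 := key (1 + 2 * ‖r‖) A⁻¹ (by linarith) (by positivity) (by linarith)
    have : |kern A κ s z - kern A κ s (z + r)| ≤ A⁻¹ := abs_le.2 ⟨by linarith, by linarith⟩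
    refine this.trans (h5.trans (le_add_of_nonneg_right (by positivity)))
  · have hz1 : 1 ≤ ‖z‖ := by
      rcases hz with rfl | hz
      · simp only [norm_zero] at h; linarith
      · exact hz
    have a1 : ‖z‖ ≤ ‖z + r‖ + ‖r‖ := by
      simpa using norm_sub_le (z + r) r
    have a2 := norm_add_le z r
    have := kern_sub_le hA hA1 hκ hs hs2 hz1 (w := z + r) (by linarith) (by linarith)
    rw [show ‖z - (z + r)‖ = ‖r‖ by simp] at this
    refine this.trans (le_trans ?_ (le_add_of_nonneg_left (by positivity)))
    rw [mul_assoc (2 ^ 27 * A⁻¹ ^ 3 * ‖r‖)]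
    gcongr
    rw [Real.rpow_neg (by linarith), Real.rpow_neg (by linarith), ← div_eq_mul_inv,
      le_div_iff₀ (by positivity), inv_mul_le_iff₀ (by positivity), ← Real.mul_rpow (by linarith)
      (by linarith)]
    gcongr
    linarith

end Kernel

section Lattice
variable {O : Type*} [AddCommGroup O] (ι : O →+ ℝ × ℝ) {A κ : ℝ}

lemma eq_zero_or_one_le (hmin : ∀ α, α ≠ 0 → 1 ≤ ‖ι α‖) (α : O) : ι α = 0 ∨ 1 ≤ ‖ι α‖ := by
  rcases eq_or_ne α 0 with rfl | h
  · simp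
  · exact Or.inr (hmin α h)

lemma summable_kern (hmin : ∀ α, α ≠ 0 → 1 ≤ ‖ι α‖)
    (hsum : ∀ t : ℝ, 2 < t → Summable fun α => (1 + ‖ι α‖) ^ (-t))
    (hA : 0 < A) (hA1 : A < 1) (hκ : |κ| = 1) {s : ℝ} (hs : 1 < s) (hs2 : s ≤ 2) :
    Summable fun α => kern A κ s (ι α) := by
  refine Summable.of_nonneg_of_le (fun α => kern_nonneg hA _ _) (fun α => ?_)
    ((hsum (2 * s) (by linarith)).mul_left (A⁻¹ * 2 ^ (2 * s)))
  rcases eq_zero_or_one_le ι hmin α with h | h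
  · rw [h, kern_zero]; positivity
  · refine (kern_le hA hA1 hκ hs2 h).trans ?_
    rw [mul_assoc]
    gcongr
    rw [Real.rpow_neg (by linarith), Real.rpow_neg (by linarith), ← div_eq_mul_inv,
      le_div_iff₀ (by positivity), inv_mul_le_iff₀ (by positivity), ← Real.mul_rpow (by linarith)
      (by linarith)]
    gcongr
    linarith

lemma exists_tsum_kern_sub_le (hmin : ∀ α, α ≠ 0 → 1 ≤ ‖ι α‖)
    (hsum : ∀ t : ℝ, 2 < t → Summable fun α => (1 + ‖ι α‖) ^ (-t))
    (hA : 0 < A) (hA1 : A < 1) (hκ : |κ| = 1) (r : O) :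
    ∃ b : O → ℝ, Summable b ∧ ∀ s : ℝ, 1 < s → s ≤ 2 →
      ∀ α, |kern A κ s (ι α) - kern A κ s (ι (α + r))| ≤ b α := by
  obtain ⟨C, hC⟩ := exists_kern_sub_le hA hA1 hκ (ι r)
  refine ⟨_, (hsum 3 (by norm_num)).mul_left C, fun s hs hs2 α => ?_⟩
  rw [map_add]
  exact hC s hs.le hs2 _ (eq_zero_or_one_le ι hmin α)
    (by rw [← map_add]; exact eq_zero_or_one_le ι hmin _)

open Classical in
lemma tsum_indicator_sub_index_inv_mul {C : AddSubgroup O} [Fintype (O ⧸ C)] [C.FiniteIndex]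
    {F : O → ℂ} (hF : Summable F) {r : O ⧸ C → O} (hr : ∀ q, (r q : O ⧸ C) = q) :
    ∑' α, ((if α ∈ C then 1 else 0) - (C.index : ℂ)⁻¹) * F α =
      (C.index : ℂ)⁻¹ * ∑ q : O ⧸ C, ∑' c : C, (F c - F (c + r q)) := by
  have hbij : Function.Bijective (fun x : (O ⧸ C) × C => (x.2 : O) + r x.1) := by
    constructor
    · rintro ⟨q, c⟩ ⟨q', c'⟩ h
      simp only at h
      have hq : q = q' := by
        have := congrArg (fun x : O => (x : O ⧸ C)) h
        simpa [hr, (QuotientAddGroup.eq_zero_iff _).2 c.2,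
          (QuotientAddGroup.eq_zero_iff _).2 c'.2] using this
      subst hq
      simpa using h
    · intro x
      refine ⟨⟨(x : O ⧸ C), ⟨x - r x, ?_⟩⟩, by simp⟩
      rw [← QuotientAddGroup.eq_zero_iff, QuotientAddGroup.mk_sub, hr, sub_self]
  let e := Equiv.ofBijective _ hbij
  have hFC : Summable fun c : C => F c := hF.subtype _
  have hFe : Summable fun x : (O ⧸ C) × C => F (e x) := e.summable_iff.2 hF
  have hFq : ∀ q, Summable fun c : C => F (c + r q) := fun q =>
    hFe.comp_injective (i := fun c => (q, c)) (fun _ _ h => by simpa using h)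
  have h1 : ∑' α, F α = ∑ q : O ⧸ C, ∑' c : C, F (c + r q) := by
    rw [← e.tsum_eq, hFe.tsum_prod' fun q => hFq q, tsum_fintype]
    rfl
  have hind : (fun α => (if α ∈ C then 1 else 0) * F α) = (C : Set O).indicator F := by
    ext α
    simp [Set.indicator_apply]
  have hk : (C.index : ℂ) ≠ 0 := Nat.cast_ne_zero.2 AddSubgroup.FiniteIndex.index_ne_zero
  have hcard : (Fintype.card (O ⧸ C) : ℂ) = C.index := by
    rw [AddSubgroup.index, Nat.card_eq_fintype_card]
  have h2s : Summable fun α => (if α ∈ C then 1 else 0) * F α := hind ▸ hF.indicator _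
  have h2 : ∑' α, (if α ∈ C then 1 else 0) * F α = ∑' c : C, F c := by
    rw [hind]
    exact (tsum_subtype (C : Set O) F).symm
  simp_rw [sub_mul]
  rw [h2s.tsum_sub (hF.mul_left _), h2, tsum_mul_left, h1]
  have : ∀ q, ∑' c : C, (F c - F (c + r q)) = ∑' c : C, F c - ∑' c : C, F (c + r q) :=
    fun q => hFC.tsum_sub (hFq q)
  simp_rw [this]
  rw [Finset.sum_sub_distrib, Finset.sum_const, Finset.card_univ, nsmul_eq_mul, hcard, mul_sub,
    inv_mul_cancel_left₀ hk]

open Classical in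
lemma exists_norm_tsum_sublattice_le (hmin : ∀ α, α ≠ 0 → 1 ≤ ‖ι α‖)
    (hsum : ∀ t : ℝ, 2 < t → Summable fun α => (1 + ‖ι α‖) ^ (-t))
    (hA : 0 < A) (hA1 : A < 1) (hκ : |κ| = 1)
    (P C : AddSubgroup O) (hPC : P ⊔ C = ⊤) [C.FiniteIndex] (g : O → ℂ)
    (hg : ∀ α, ∀ p ∈ P, g (α + p) = g α) (hg1 : ∀ α, ‖g α‖ ≤ 1) :
    ∃ B : ℝ, ∀ s : ℝ, 1 < s → s ≤ 2 →
      ‖∑' α, ((if α ∈ C then 1 else 0) - (C.index : ℂ)⁻¹) * (g α * kern A κ s (ι α))‖ ≤ B := by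
  have hrep : ∀ q : O ⧸ C, ∃ r ∈ P, (r : O ⧸ C) = q := by
    intro q
    obtain ⟨x, rfl⟩ := QuotientAddGroup.mk_surjective q
    obtain ⟨p, hp, c, hc, rfl⟩ := AddSubgroup.mem_sup.1 (hPC ▸ AddSubgroup.mem_top x : x ∈ P ⊔ C)
    exact ⟨p, hp, by rw [QuotientAddGroup.eq]; simpa using hc⟩
  choose r hrP hr using hrep
  choose b hb hbF using fun q => exists_tsum_kern_sub_le ι hmin hsum hA hA1 hκ (r q)
  have : Fintype (O ⧸ C) := Fintype.ofFinite _
  refine ⟨(C.index : ℝ)⁻¹ * ∑ q, ∑' c : C, b q c, fun s hs hs2 => ?_⟩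
  have hFs : Summable fun α => g α * kern A κ s (ι α) := by
    refine Summable.of_norm_bounded (summable_kern ι hmin hsum hA hA1 hκ hs hs2) fun α => ?_
    rw [norm_mul, Complex.norm_real, Real.norm_of_nonneg (kern_nonneg hA _ _)]
    exact mul_le_of_le_one_left (kern_nonneg hA _ _) (hg1 α)
  rw [tsum_indicator_sub_index_inv_mul hFs hr, norm_mul, norm_inv, Complex.norm_natCast]
  gcongr
  refine (norm_sum_le _ _).trans (Finset.sum_le_sum fun q _ => ?_)
  refine tsum_of_norm_bounded ((hb q).subtype (C : Set O)).hasSum fun c => ?_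
  rw [hg _ _ (hrP q), ← mul_sub, ← Complex.ofReal_sub, norm_mul, Complex.norm_real]
  exact (mul_le_of_le_one_left (norm_nonneg _) (hg1 _)).trans (hbF q s hs hs2 _)

end Lattice

section Quadratic
variable {K : Type*} [Field K]

/-- The pair of real embeddings of a real quadratic field, on the ring of integers. -/
noncomputable def realPair (φ₁ φ₂ : K →+* ℝ) : 𝓞 K →+ ℝ × ℝ :=
  ((φ₁.comp (algebraMap (𝓞 K) K)).toAddMonoidHom).prod
    ((φ₂.comp (algebraMap (𝓞 K) K)).toAddMonoidHom)

lemma realPair_apply (φ₁ φ₂ : K →+* ℝ) (α : 𝓞 K) : realPair φ₁ φ₂ α = (φ₁ α, φ₂ α) := rfl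

variable [NumberField K]
lemma exists_real_embeddings [IsTotallyReal K] (h2 : finrank ℚ K = 2) :
    ∃ φ₁ φ₂ : K →+* ℝ, ∀ x, φ₁ x * φ₂ x = Algebra.norm ℚ x := by
  classical
  have hcard : Fintype.card (K →ₐ[ℚ] ℂ) = 2 := by rw [AlgHom.card, h2]
  obtain ⟨a, b, hab, huniv⟩ := Finset.card_eq_two.1 (Finset.card_univ.trans hcard)
  have hr (c : K →+* ℂ) := IsTotallyReal.complexEmbedding_isReal c
  refine ⟨(hr a.toRingHom).embedding, (hr b.toRingHom).embedding, fun x => ?_⟩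
  have h := Algebra.norm_eq_prod_embeddings ℚ ℂ x
  rw [huniv, Finset.prod_pair hab] at h
  apply Complex.ofReal_injective
  push_cast
  rw [ComplexEmbedding.IsReal.coe_embedding_apply, ComplexEmbedding.IsReal.coe_embedding_apply]
  simpa using h.symm

variable {φ₁ φ₂ : K →+* ℝ}

lemma mul_eq_norm (hφ : ∀ x, φ₁ x * φ₂ x = Algebra.norm ℚ x)
    (α : 𝓞 K) : φ₁ α * φ₂ α = Algebra.norm ℤ α := by
  rw [hφ, ← Algebra.coe_norm_int]; simp

lemma one_le_abs_mul (hφ : ∀ x, φ₁ x * φ₂ x = Algebra.norm ℚ x)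
    {α : 𝓞 K} (h : α ≠ 0) : 1 ≤ |φ₁ α * φ₂ α| := by
  rw [mul_eq_norm hφ, ← Int.cast_abs]
  exact_mod_cast Int.one_le_abs (Algebra.norm_ne_zero_iff.2 h)

lemma one_le_norm_realPair (hφ : ∀ x, φ₁ x * φ₂ x = Algebra.norm ℚ x)
    (α : 𝓞 K) (h : α ≠ 0) : 1 ≤ ‖realPair φ₁ φ₂ α‖ := by
  by_contra! hlt
  have h1 := (abs_fst_le (realPair φ₁ φ₂ α)).trans_lt hlt
  have h2 := (abs_snd_le (realPair φ₁ φ₂ α)).trans_lt hlt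
  have := one_le_abs_mul hφ h
  rw [abs_mul] at this
  rw [realPair_apply] at h1 h2
  nlinarith [abs_nonneg (φ₁ α), abs_nonneg (φ₂ α)]

lemma realPair_injective (hφ : ∀ x, φ₁ x * φ₂ x = Algebra.norm ℚ x) :
    Function.Injective (realPair φ₁ φ₂) := by
  refine (injective_iff_map_eq_zero _).2 fun α h => by_contra fun h0 => ?_
  have := one_le_norm_realPair hφ α h0
  rw [h, norm_zero] at this
  linarith

lemma summable_realPair (hφ : ∀ x, φ₁ x * φ₂ x = Algebra.norm ℚ x)
    (h2 : finrank ℚ K = 2) (t : ℝ) (ht : 2 < t) :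
    Summable fun α => (1 + ‖realPair φ₁ φ₂ α‖) ^ (-t) := by
  let ι := (realPair φ₁ φ₂).toIntLinearMap
  have hinj : Function.Injective ι := realPair_injective hφ
  let e := LinearEquiv.ofInjective ι hinj
  have : DiscreteTopology (LinearMap.range ι) := by
    refine DiscreteTopology.of_forall_le_norm (r := 1) one_pos fun x hx => ?_
    obtain ⟨_, α, rfl⟩ := x
    exact one_le_norm_realPair hφ α fun h => hx (by ext <;> simp [h])
  have hfr : finrank ℤ (LinearMap.range ι) = 2 := by
    rw [← e.finrank_eq, RingOfIntegers.rank, h2]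
  have hs := ZLattice.summable_norm_rpow (LinearMap.range ι) (-t) (by rw [hfr]; push_cast; linarith)
  refine Summable.of_norm_bounded_eventually (e.toEquiv.summable_iff.2 hs) ?_
  filter_upwards [(Set.finite_singleton (0 : 𝓞 K)).compl_mem_cofinite] with α hα
  have := one_le_norm_realPair hφ α hα
  rw [Real.norm_of_nonneg (by positivity)]
  exact Real.rpow_le_rpow_of_nonpos (by positivity)
    (by linarith [show ‖realPair φ₁ φ₂ α‖ = ‖(e α)‖ from rfl,
      show ‖((e.toEquiv α : LinearMap.range ι))‖ = ‖(e α)‖ from rfl]) (by linarith)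

end Quadratic

section TelescopingSums
open Filter Topology

lemma hasSum_int_sub_of_antitone {h : ℤ → ℝ} (hanti : Antitone h) {a b : ℝ}
    (htop : Tendsto (fun k : ℕ => h k) atTop (𝓝 a))
    (hbot : Tendsto (fun k : ℕ => h (-k)) atTop (𝓝 b)) :
    HasSum (fun k => h k - h (k + 1)) (b - a) := by
  have h1 : HasSum (fun k : ℕ => h k - h (k + 1)) (h 0 - a) := by
    rw [hasSum_iff_tendsto_nat_of_nonneg fun k => sub_nonneg.2 (hanti (by lia))]
    refine (htop.const_sub (h 0)).congr fun k => ?_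
    exact_mod_cast (Finset.sum_range_sub' (fun k : ℕ => h k) k).symm
  have h2 : HasSum (fun k : ℕ => h (-(k + 1)) - h (-(k + 1) + 1)) (b - h 0) := by
    rw [hasSum_iff_tendsto_nat_of_nonneg fun k => sub_nonneg.2 (hanti (by lia))]
    refine (hbot.sub_const (h 0)).congr fun k => ?_
    rw [← neg_zero, ← Nat.cast_zero, ← Finset.sum_range_sub (fun k : ℕ => h (-k)) k]
    refine Finset.sum_congr rfl fun i _ => ?_
    rw [show (-((i : ℤ) + 1) + 1) = -i by ring]
    push_cast
    rfl
  have := HasSum.of_nat_of_neg_add_one (f := fun k => h k - h (k + 1)) h1 h2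
  rwa [sub_add_sub_cancel'] at this

/-- The weight whose sum over the multiples of `z` by powers of a fundamental unit is one. -/
noncomputable def wt (A : ℝ) (z : ℝ × ℝ) : ℝ :=
  z.1 ^ 4 / (z.1 ^ 4 + z.2 ^ 4) - A * z.1 ^ 4 / (A * z.1 ^ 4 + A⁻¹ * z.2 ^ 4)

lemma wt_zero (A : ℝ) : wt A 0 = 0 := by simp [wt]

lemma wt_mul_rpow {A s : ℝ} (hA : 0 < A) (hs : s < 4) {z : ℝ × ℝ} (hz : z.1 * z.2 ≠ 0) :
    wt A z * |z.1 * z.2| ^ (-s) = (A⁻¹ - A) * (kern A 1 s z + kern A (-1) s z) := by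
  have hx : 0 < z.1 ^ 4 := by have := left_ne_zero_of_mul hz; positivity
  have hy : 0 < z.2 ^ 4 := by have := right_ne_zero_of_mul hz; positivity
  have h1 : max (1 * (z.1 * z.2)) 0 ^ (4 - s) + max (-1 * (z.1 * z.2)) 0 ^ (4 - s) =
      |z.1 * z.2| ^ (4 - s) := by
    rcases lt_or_gt_of_ne hz with h | h
    · rw [max_eq_right (by linarith), max_eq_left (by linarith), abs_of_neg h,
        Real.zero_rpow (by linarith), zero_add, neg_one_mul]
    · rw [max_eq_left (by linarith), max_eq_right (by linarith), abs_of_pos h,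
        Real.zero_rpow (by linarith), add_zero, one_mul]
  have h2 : |z.1 * z.2| ^ (4 - s) = z.1 ^ 4 * z.2 ^ 4 * |z.1 * z.2| ^ (-s) := by
    rw [sub_eq_add_neg, Real.rpow_add (abs_pos.2 hz)]
    congr 1
    rw [show (4 : ℝ) = (4 : ℕ) by norm_num, Real.rpow_natCast, Even.pow_abs (by decide), mul_pow]
  unfold kern
  rw [← add_div, h1, h2, wt]
  have : 0 < A * z.1 ^ 4 + A⁻¹ * z.2 ^ 4 := by positivity
  have hA' := hA.ne'
  rw [div_sub_div _ _ (by positivity) this.ne']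
  rw [div_mul_eq_mul_div, mul_div_assoc']
  congr 1
  field_simp
  ring

lemma wt_nonneg {A : ℝ} (hA : 0 < A) (hA1 : A < 1) {z : ℝ × ℝ} (hz : z.1 * z.2 ≠ 0) :
    0 ≤ wt A z := by
  have h := wt_mul_rpow (s := 0) hA (by norm_num) hz
  rw [neg_zero, Real.rpow_zero, mul_one] at h
  rw [h]
  have : A ≤ A⁻¹ := hA1.le.trans ((one_le_inv₀ hA).2 hA1.le)
  exact mul_nonneg (by linarith) (add_nonneg (kern_nonneg hA _ _) (kern_nonneg hA _ _))

lemma hasSum_wt {A a b x y : ℝ} (hA1 : A < 1) (hA : 0 < A) (ha : a ^ 4 = A)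
    (hb : b ^ 4 = A⁻¹) (hx : x ≠ 0) (hy : y ≠ 0) :
    HasSum (fun k : ℤ => wt A (a ^ k * x, b ^ k * y)) 1 := by
  have ha0 : a ≠ 0 := by rintro rfl; norm_num at ha; exact hA.ne ha
  have hb0 : b ≠ 0 := by rintro rfl; norm_num at hb; exact hA.ne hb
  have hx4 : 0 < x ^ 4 := by positivity
  have hy4 : 0 < y ^ 4 := by positivity
  set h : ℤ → ℝ := fun k => x ^ 4 / (x ^ 4 + (A⁻¹ ^ 2) ^ k * y ^ 4) with hh
  have hB : 1 < A⁻¹ ^ 2 := one_lt_pow₀ ((one_lt_inv₀ hA).2 hA1) two_ne_zero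
  have hanti : Antitone h := by
    intro k l hkl
    simp only [hh]
    gcongr
    exact hB.le
  have htend : Tendsto (fun k : ℕ => (A⁻¹ ^ 2) ^ k) atTop atTop :=
    tendsto_pow_atTop_atTop_of_one_lt hB
  have htop : Tendsto (fun k : ℕ => h k) atTop (𝓝 0) :=
    (tendsto_atTop_add_const_left _ (x ^ 4) (htend.atTop_mul_const hy4)).const_div_atTop (x ^ 4)
  have hbot : Tendsto (fun k : ℕ => h (-k)) atTop (𝓝 1) := by
    have h0 : Tendsto (fun k : ℕ => x ^ 4 + ((A⁻¹ ^ 2) ^ k)⁻¹ * y ^ 4) atTop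
        (𝓝 (x ^ 4 + 0 * y ^ 4)) := (htend.inv_tendsto_atTop.mul_const _).const_add _
    have h1 := (tendsto_const_nhds (x := x ^ 4)).div h0 (by simpa using hx)
    rw [zero_mul, add_zero, div_self hx4.ne'] at h1
    refine h1.congr fun k => ?_
    simp [hh]
  have := hasSum_int_sub_of_antitone hanti htop hbot
  rw [sub_zero] at this
  convert this using 2 with k
  have hA' := hA.ne'
  have e1 : (a ^ k * x) ^ 4 = A ^ k * x ^ 4 := by
    rw [mul_pow, ← zpow_natCast, zpow_comm, zpow_natCast, ha]
  have e2 : (b ^ k * y) ^ 4 = (A ^ k)⁻¹ * y ^ 4 := by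
    rw [mul_pow, ← zpow_natCast, zpow_comm, zpow_natCast, hb, inv_zpow]
  have e3 : (A⁻¹ ^ 2) ^ k = (A ^ k)⁻¹ ^ 2 := by
    rw [← zpow_natCast, zpow_comm, zpow_natCast, inv_zpow]
  simp only [wt, hh]
  rw [e1, e2, e3, zpow_add_one₀ (by positivity), e3]
  have hk : 0 < A ^ k := zpow_pos hA k
  generalize A ^ k = c at hk
  congr 1
  · rw [div_eq_div_iff (by positivity) (by positivity)]
    field_simp
  · rw [div_eq_div_iff (by positivity) (by positivity)]
    field_simp

end TelescopingSums

section Quadratic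
variable {K : Type*} [Field K] {φ₁ φ₂ : K →+* ℝ}

lemma abs_real_eq_one_of_mem_torsion (φ : K →+* ℝ) {ζ : (𝓞 K)ˣ} (hζ : ζ ∈ Units.torsion K) :
    |φ (ζ : 𝓞 K)| = 1 := by
  obtain ⟨k, hk, h⟩ := isOfFinOrder_iff_pow_eq_one.1 ((CommGroup.mem_torsion _).1 hζ)
  refine pow_eq_one_iff_of_nonneg (abs_nonneg _) hk.ne' |>.1 ?_
  have := congrArg (fun u : (𝓞 K)ˣ => φ (u : 𝓞 K)) h
  rw [← abs_pow]
  simpa using congrArg abs this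

lemma map_units_zpow (φ : K →+* ℝ) (ε : (𝓞 K)ˣ) (k : ℤ) :
    φ ((ε ^ k : (𝓞 K)ˣ) : 𝓞 K) = φ (ε : 𝓞 K) ^ k :=
  (congrArg Units.val
    (map_zpow (Units.map (φ.comp (algebraMap (𝓞 K) K)).toMonoidHom) ε k)).trans
    (Units.val_zpow_eq_zpow_val _ _)

variable [NumberField K]

lemma exists_fundamental_unit [IsTotallyReal K] (h2 : finrank ℚ K = 2) (φ : K →+* ℝ) :
    ∃ ε : (𝓞 K)ˣ, |φ (ε : 𝓞 K)| < 1 ∧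
      Function.Bijective fun p : Units.torsion K × ℤ => (p.1 : (𝓞 K)ˣ) * ε ^ p.2 := by
  have hrank : Units.rank K = 1 := by
    rw [Units.rank, InfinitePlace.card_eq_nrRealPlaces_add_nrComplexPlaces,
      IsTotallyReal.nrComplexPlaces_eq_zero, ← IsTotallyReal.finrank, h2]
  obtain ⟨ε, hε⟩ : ∃ ε : (𝓞 K)ˣ,
      Function.Bijective fun p : Units.torsion K × ℤ => (p.1 : (𝓞 K)ˣ) * ε ^ p.2 := by
    have := (finCongr hrank).unique
    refine ⟨Units.fundSystem K default, ?_⟩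
    have hb : Function.Bijective fun p : Units.torsion K × (Fin (Units.rank K) → ℤ) =>
        (p.1 : (𝓞 K)ˣ) * ∏ i, Units.fundSystem K i ^ p.2 i := by
      refine (Function.bijective_iff_existsUnique _).2 fun u => ?_
      obtain ⟨p, hp, hu⟩ := Units.exist_unique_eq_mul_prod K u
      exact ⟨p, hp.symm, fun q hq => hu q hq.symm⟩
    convert hb.comp ((Equiv.refl (Units.torsion K)).prodCongr
      (Equiv.funUnique (Fin (Units.rank K)) ℤ).symm).bijective using 2 with p
    simp [Equiv.funUnique]
  have h1 : |φ (ε : 𝓞 K)| ≠ 1 := by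
    intro h
    have h2 : ε ^ 2 = 1 := by
      have : φ ((ε : 𝓞 K) ^ 2 : 𝓞 K) = φ ((1 : 𝓞 K)) := by
        push_cast
        rw [map_pow, ← sq_abs, h]; simp
      exact Units.ext (RingOfIntegers.ext (φ.injective this))
    have := @hε.1 (1, 2) (1, 0) (by simpa using mod_cast h2)
    simp at this
  rcases lt_or_gt_of_ne h1 with h | h
  · exact ⟨ε, h, hε⟩
  · refine ⟨ε⁻¹, ?_, ?_⟩
    · have : φ (ε : 𝓞 K) * φ ((ε⁻¹ : (𝓞 K)ˣ) : 𝓞 K) = 1 := by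
        rw [← map_mul, ← map_mul]; simp
      have h3 := congrArg abs this
      rw [abs_mul, abs_one] at h3
      nlinarith [abs_nonneg (φ ((ε⁻¹ : (𝓞 K)ˣ) : 𝓞 K))]
    · convert hε.comp ((Equiv.refl (Units.torsion K)).prodCongr (Equiv.neg ℤ)).bijective
        using 2 with p
      simp

lemma wt_congr {A : ℝ} {z w : ℝ × ℝ} (h1 : z.1 ^ 4 = w.1 ^ 4) (h2 : z.2 ^ 4 = w.2 ^ 4) :
    wt A z = wt A w := by simp [wt, h1, h2]

lemma pow_four_eq_inv (hφ : ∀ x, φ₁ x * φ₂ x = Algebra.norm ℚ x)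
    (ε : (𝓞 K)ˣ) : φ₂ (ε : 𝓞 K) ^ 4 = (φ₁ (ε : 𝓞 K) ^ 4)⁻¹ := by
  refine eq_inv_of_mul_eq_one_left ?_
  rw [← mul_pow, mul_comm, mul_eq_norm hφ]
  rcases Int.isUnit_iff.1 (ε.isUnit.map (Algebra.norm ℤ)) with h | h <;> norm_num [h]

lemma hasSum_units_wt (hφ : ∀ x, φ₁ x * φ₂ x = Algebra.norm ℚ x)
    {ε : (𝓞 K)ˣ} (hε1 : |φ₁ (ε : 𝓞 K)| < 1)
    (hε : Function.Bijective fun p : Units.torsion K × ℤ => (p.1 : (𝓞 K)ˣ) * ε ^ p.2)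
    {α : 𝓞 K} (hα : α ≠ 0) :
    HasSum (fun u : (𝓞 K)ˣ => wt (φ₁ (ε : 𝓞 K) ^ 4) (realPair φ₁ φ₂ (u * α)))
      (Nat.card (Units.torsion K)) := by
  have hA : 0 < φ₁ (ε : 𝓞 K) ^ 4 := by
    have : φ₁ (ε : 𝓞 K) ≠ 0 := by simp
    positivity
  have hA1 : φ₁ (ε : 𝓞 K) ^ 4 < 1 := by
    rw [← Even.pow_abs (by decide)]
    exact pow_lt_one₀ (abs_nonneg _) hε1 (by norm_num)
  have hx : φ₁ α ≠ 0 := by simpa using hα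
  have hy : φ₂ α ≠ 0 := by simpa using hα
  have h := hasSum_wt hA1 hA rfl (pow_four_eq_inv hφ ε) hx hy
  have hn : ∀ k : ℤ, 0 ≤ wt (φ₁ (ε : 𝓞 K) ^ 4) (φ₁ (ε : 𝓞 K) ^ k * φ₁ α, φ₂ (ε : 𝓞 K) ^ k * φ₂ α) :=
    fun k => wt_nonneg hA hA1 (by simp [hx, hy, zpow_ne_zero])
  have : Fintype (Units.torsion K) := Fintype.ofFinite _
  have h0 := hasSum_fintype fun _ : Units.torsion K => (1 : ℝ)
  have h1 := h0.mul h (h0.summable.mul_of_nonneg h.summable (fun _ => zero_le_one) hn)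
  have h2 : (∑ _ : Units.torsion K, (1 : ℝ)) * 1 = Nat.card (Units.torsion K) := by simp
  rw [h2] at h1
  rw [← (Equiv.ofBijective _ hε).hasSum_iff]
  refine h1.congr_fun fun p => ?_
  simp only [Function.comp_apply, Equiv.ofBijective_apply, one_mul]
  refine wt_congr ?_ ?_
  · have := abs_real_eq_one_of_mem_torsion φ₁ p.1.2
    simp only [realPair_apply, Units.val_mul, map_mul, mul_pow]
    rw [← Even.pow_abs (by decide) (φ₁ ((p.1 : (𝓞 K)ˣ) : 𝓞 K)), this, one_pow, one_mul,
      map_units_zpow]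
  · have := abs_real_eq_one_of_mem_torsion φ₂ p.1.2
    simp only [realPair_apply, Units.val_mul, map_mul, mul_pow]
    rw [← Even.pow_abs (by decide) (φ₂ ((p.1 : (𝓞 K)ˣ) : 𝓞 K)), this, one_pow, one_mul,
      map_units_zpow]

lemma exists_equiv_class (𝔟 : (Ideal (𝓞 K))⁰) :
    ∃ e : {𝔞 : (Ideal (𝓞 K))⁰ // ClassGroup.mk0 𝔞 * ClassGroup.mk0 𝔟 = 1} × (𝓞 K)ˣ ≃
      {α : 𝓞 K // α ∈ (𝔟 : Ideal (𝓞 K)) ∧ α ≠ 0},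
    ∃ γ : {𝔞 : (Ideal (𝓞 K))⁰ // ClassGroup.mk0 𝔞 * ClassGroup.mk0 𝔟 = 1} → 𝓞 K,
      (∀ x, (e x : 𝓞 K) = x.2 * γ x.1) ∧ (∀ 𝔞, γ 𝔞 ≠ 0) ∧
      ∀ 𝔞, Ideal.span {γ 𝔞} = (𝔞 : Ideal (𝓞 K)) * (𝔟 : Ideal (𝓞 K)) := by
  have h (𝔞 : {𝔞 : (Ideal (𝓞 K))⁰ // ClassGroup.mk0 𝔞 * ClassGroup.mk0 𝔟 = 1}) :
      ∃ γ, Ideal.span {γ} = (𝔞 : Ideal (𝓞 K)) * (𝔟 : Ideal (𝓞 K)) := by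
    have h1 := 𝔞.2
    rw [← map_mul, ClassGroup.mk0_eq_one_iff] at h1
    obtain ⟨γ, hγ⟩ := h1.principal
    exact ⟨γ, by simpa using hγ.symm⟩
  choose γ hγ using h
  have hγ0 : ∀ 𝔞, γ 𝔞 ≠ 0 := by
    intro 𝔞 h0
    have h1 := hγ 𝔞
    rw [h0, Ideal.span_singleton_zero, eq_comm] at h1
    exact nonZeroDivisors.ne_zero (mul_mem 𝔞.1.2 𝔟.2) h1
  have hspan (u : (𝓞 K)ˣ) 𝔞 : Ideal.span {(u : 𝓞 K) * γ 𝔞} =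
      (𝔞 : Ideal (𝓞 K)) * (𝔟 : Ideal (𝓞 K)) := by
    rw [← hγ, Ideal.span_singleton_eq_span_singleton]
    exact associated_unit_mul_left _ _ u.isUnit
  refine ⟨Equiv.ofBijective (fun x => ⟨x.2 * γ x.1, ?_, by simp [hγ0]⟩) ⟨?_, ?_⟩, γ, fun x => rfl,
    hγ0, hγ⟩
  · rw [← Ideal.span_singleton_le_iff_mem, hspan]
    exact Ideal.mul_le_right
  · rintro ⟨𝔞, u⟩ ⟨𝔞', u'⟩ h
    simp only [Subtype.mk.injEq] at h
    have h1 := congrArg (fun x => Ideal.span {x}) h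
    simp only [hspan] at h1
    have h2 : 𝔞 = 𝔞' :=
      Subtype.ext (Subtype.ext (mul_right_cancel₀ (nonZeroDivisors.ne_zero 𝔟.2) h1))
    subst h2
    simpa [hγ0, Units.ext_iff] using h
  · rintro ⟨α, hα, hα0⟩
    obtain ⟨𝔠, h𝔠⟩ := Ideal.dvd_span_singleton.2 hα
    have h𝔠0 : 𝔠 ∈ (Ideal (𝓞 K))⁰ := mem_nonZeroDivisors_of_ne_zero <| by
      rintro rfl
      rw [mul_zero] at h𝔠
      exact hα0 (by simpa using h𝔠)
    have hcl : ClassGroup.mk0 ⟨𝔠, h𝔠0⟩ * ClassGroup.mk0 𝔟 = 1 := by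
      rw [← map_mul, ClassGroup.mk0_eq_one_iff]
      exact ⟨⟨α, by simpa [mul_comm] using h𝔠.symm⟩⟩
    have h2 := hγ ⟨⟨𝔠, h𝔠0⟩, hcl⟩
    simp only at h2
    rw [mul_comm, ← h𝔠, Ideal.span_singleton_eq_span_singleton] at h2
    obtain ⟨u, hu⟩ := h2
    exact ⟨⟨⟨⟨𝔠, h𝔠0⟩, hcl⟩, u⟩, Subtype.ext (by simpa [mul_comm] using hu)⟩

open Classical in
lemma hasSum_class (hφ : ∀ x, φ₁ x * φ₂ x = Algebra.norm ℚ x)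
    {ε : (𝓞 K)ˣ} (hε1 : |φ₁ (ε : 𝓞 K)| < 1)
    (hε : Function.Bijective fun p : Units.torsion K × ℤ => (p.1 : (𝓞 K)ˣ) * ε ^ p.2)
    (𝔟 : (Ideal (𝓞 K))⁰) (G : Ideal (𝓞 K) → ℂ)
    (hs : Summable fun α => if α ∈ (𝔟 : Ideal (𝓞 K)) then
      G (Ideal.span {α}) * wt (φ₁ (ε : 𝓞 K) ^ 4) (realPair φ₁ φ₂ α) else 0) :
    HasSum (fun 𝔞 : {𝔞 : (Ideal (𝓞 K))⁰ // ClassGroup.mk0 𝔞 * ClassGroup.mk0 𝔟 = 1} =>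
      G ((𝔞 : Ideal (𝓞 K)) * (𝔟 : Ideal (𝓞 K))) * (Nat.card (Units.torsion K) : ℂ))
      (∑' α, if α ∈ (𝔟 : Ideal (𝓞 K)) then
        G (Ideal.span {α}) * wt (φ₁ (ε : 𝓞 K) ^ 4) (realPair φ₁ φ₂ α) else 0) := by
  obtain ⟨e, γ, he, hγ0, hγ⟩ := exists_equiv_class 𝔟
  have h1 := hs.hasSum
  rw [← hasSum_subtype_iff_of_support_subset
    (s := {α : 𝓞 K | α ∈ (𝔟 : Ideal (𝓞 K)) ∧ α ≠ 0}) ?_] at h1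
  · refine (e.hasSum_iff.2 h1).prod_fiberwise fun 𝔞 => ?_
    have h2 := (Complex.hasSum_ofReal.2 (hasSum_units_wt hφ hε1 hε (hγ0 𝔞))).mul_left
      (G ((𝔞 : Ideal (𝓞 K)) * (𝔟 : Ideal (𝓞 K))))
    rw [Complex.ofReal_natCast] at h2
    refine h2.congr_fun fun u => ?_
    simp only [Function.comp_apply, if_pos (e (𝔞, u)).2.1]
    rw [he, ← hγ]
    congr 2
    exact Ideal.span_singleton_eq_span_singleton.2 (associated_unit_mul_left _ _ u.isUnit)
  · intro α hα
    refine ⟨by_contra fun h => hα (if_neg h), fun h => hα ?_⟩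
    simp [h, wt_zero]

end Quadratic

section Quadratic
variable {K : Type*} [Field K] [NumberField K] {φ₁ φ₂ : K →+* ℝ}

lemma dvd_norm_add_natCast_mul_sub (m : ℕ) (α β : 𝓞 K) :
    (m : ℤ) ∣ Algebra.norm ℤ (α + m * β) - Algebra.norm ℤ α := by
  classical
  rw [← ZMod.intCast_eq_intCast_iff_dvd_sub]
  let b := RingOfIntegers.basis K
  have h (x : 𝓞 K) : ((Algebra.norm ℤ x : ℤ) : ZMod m) =
      ((Int.castRingHom (ZMod m)).mapMatrix (Algebra.leftMulMatrix b x)).det := by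
    rw [← RingHom.map_det, ← Algebra.norm_eq_matrix_det, Int.coe_castRingHom]
  have h0 : (Int.castRingHom (ZMod m)).mapMatrix (Algebra.leftMulMatrix b (m : 𝓞 K)) = 0 := by
    rw [map_natCast, map_natCast]
    ext i j
    simp [Matrix.natCast_apply]
  rw [h, h, map_add, map_mul, map_add, map_mul, h0, zero_mul, add_zero]

open Classical in
/-- The value at `κ N(α) / N(𝔟)` of a Dirichlet character, on the lattice `𝔟`. -/
noncomputable def normChar {n : ℕ} (η : DirichletCharacter ℂ n) (𝔟 : Ideal (𝓞 K)) (κ : ℤ)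
    (α : 𝓞 K) : ℂ :=
  if α ∈ 𝔟 then η ((κ * (Algebra.norm ℤ α / Ideal.absNorm 𝔟) : ℤ) : ZMod n) else 0

lemma norm_normChar_le {n : ℕ} (η : DirichletCharacter ℂ n) (𝔟 : Ideal (𝓞 K)) (κ : ℤ)
    (α : 𝓞 K) : ‖normChar η 𝔟 κ α‖ ≤ 1 := by
  unfold normChar
  split_ifs
  · exact η.norm_le_one _
  · simp

lemma normChar_add {n : ℕ} (η : DirichletCharacter ℂ n) {𝔟 : Ideal (𝓞 K)} (h𝔟 : 𝔟 ≠ ⊥) (κ : ℤ)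
    (α β : 𝓞 K) :
    normChar η 𝔟 κ (α + (n * Ideal.absNorm 𝔟 : ℕ) * β) = normChar η 𝔟 κ α := by
  have hN : ((n * Ideal.absNorm 𝔟 : ℕ) : 𝓞 K) * β ∈ 𝔟 := by
    rw [Nat.cast_mul]
    exact 𝔟.mul_mem_right _ (𝔟.mul_mem_left _ (Ideal.absNorm_mem 𝔟))
  have hN0 : (Ideal.absNorm 𝔟 : ℤ) ≠ 0 :=
    Nat.cast_ne_zero.2 (Ideal.absNorm_eq_zero_iff.not.2 h𝔟)
  have hiff : α + ((n * Ideal.absNorm 𝔟 : ℕ) : 𝓞 K) * β ∈ 𝔟 ↔ α ∈ 𝔟 := 𝔟.add_mem_iff_left hN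
  by_cases h : α ∈ 𝔟
  · rw [normChar, normChar, if_pos h, if_pos (hiff.2 h)]
    obtain ⟨t, ht⟩ := dvd_norm_add_natCast_mul_sub (n * Ideal.absNorm 𝔟) α β
    rw [sub_eq_iff_eq_add] at ht
    rw [ht, Nat.cast_mul, show (n : ℤ) * Ideal.absNorm 𝔟 * t + Algebra.norm ℤ α =
      Algebra.norm ℤ α + n * t * Ideal.absNorm 𝔟 by ring, Int.add_mul_ediv_right _ _ hN0]
    simp
  · rw [normChar, normChar, if_neg h, if_neg (hiff.not.2 h)]

open Classical in
lemma norm_tsum_normChar_le (hφ : ∀ x, φ₁ x * φ₂ x = Algebra.norm ℚ x)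
    (h2 : finrank ℚ K = 2) {n : ℕ} (η : DirichletCharacter ℂ n)
    {A : ℝ} (hA : 0 < A) (hA1 : A < 1)
    {κ : ℤ} (hκ : |(κ : ℝ)| = 1) {𝔟 𝔠 : Ideal (𝓞 K)} (h𝔟 : 𝔟 ≠ ⊥) (h𝔠 : 𝔠 ≠ ⊥)
    (hcop : IsCoprime (Ideal.span {((n * Ideal.absNorm 𝔟 : ℕ) : 𝓞 K)}) 𝔠) :
    ∃ B : ℝ, ∀ s : ℝ, 1 < s → s ≤ 2 →
      ‖∑' α, ((if α ∈ 𝔠 then 1 else 0) - (Ideal.absNorm 𝔠 : ℂ)⁻¹) *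
        (normChar η 𝔟 κ α * kern A κ s (realPair φ₁ φ₂ α))‖ ≤ B := by
  have hfi : 𝔠.toAddSubgroup.FiniteIndex := by
    exact ⟨Ideal.absNorm_eq_zero_iff.not.2 h𝔠⟩
  have hPC : (Ideal.span {((n * Ideal.absNorm 𝔟 : ℕ) : 𝓞 K)}).toAddSubgroup ⊔ 𝔠.toAddSubgroup
      = ⊤ := by
    rw [← Submodule.sup_toAddSubgroup, hcop.sup_eq]; rfl
  have := exists_norm_tsum_sublattice_le (realPair φ₁ φ₂) (one_le_norm_realPair hφ)
    (summable_realPair hφ h2) hA hA1 hκ _ _ hPC (normChar η 𝔟 κ) (fun α p hp => ?_)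
    (norm_normChar_le η 𝔟 κ)
  · obtain ⟨B, hB⟩ := this
    exact ⟨B, fun s hs hs2 => hB s hs hs2⟩
  · obtain ⟨β, rfl⟩ := Ideal.mem_span_singleton.1
      (show p ∈ Ideal.span {((n * Ideal.absNorm 𝔟 : ℕ) : 𝓞 K)} from hp)
    exact normChar_add η h𝔟 κ α β

end Quadratic

lemma kern_eq_zero {A κ s : ℝ} (hs : s < 4) {z : ℝ × ℝ} (h : κ * (z.1 * z.2) ≤ 0) :
    kern A κ s z = 0 := by
  rw [kern, max_eq_right h, Real.zero_rpow (by linarith), zero_div]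

section Quadratic
variable {K : Type*} [Field K] [NumberField K] {φ₁ φ₂ : K →+* ℝ}

lemma char_mul_kern (hφ : ∀ x, φ₁ x * φ₂ x = Algebra.norm ℚ x)
    {n : ℕ} (η : DirichletCharacter ℂ n) {𝔟 : Ideal (𝓞 K)} {α : 𝓞 K}
    (hα : α ∈ 𝔟) {κ : ℤ} (hκ : κ = 1 ∨ κ = -1) {A s : ℝ} (hs : s < 4) :
    η ((Ideal.absNorm (Ideal.span {α}) / Ideal.absNorm 𝔟 : ℕ) : ZMod n) *
      (kern A κ s (realPair φ₁ φ₂ α) : ℂ) =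
    normChar η 𝔟 κ α * kern A κ s (realPair φ₁ φ₂ α) := by
  rcases le_or_gt (κ * ((realPair φ₁ φ₂ α).1 * (realPair φ₁ φ₂ α).2)) 0 with h | h
  · rw [kern_eq_zero hs h, Complex.ofReal_zero, mul_zero, mul_zero]
  · rw [realPair_apply, mul_eq_norm hφ] at h
    have h : 0 < κ * Algebra.norm ℤ α := by exact_mod_cast h
    rw [normChar, if_pos hα]
    congr 2
    rw [← Int.cast_natCast (R := ZMod n)]
    congr 1
    rw [Ideal.absNorm_span_singleton, Int.natCast_div, Int.natCast_natAbs]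
    have hdvd := Ideal.absNorm_dvd_norm_of_mem hα
    rcases hκ with rfl | rfl
    · rw [abs_of_pos (by linarith), one_mul]
    · rw [abs_of_neg (by linarith), neg_one_mul, Int.neg_ediv_of_dvd hdvd]

lemma absNorm_div_rpow_mul_wt (hφ : ∀ x, φ₁ x * φ₂ x = Algebra.norm ℚ x)
    {𝔟 : Ideal (𝓞 K)} {α : 𝓞 K} (hα : α ∈ 𝔟) {A s : ℝ} (hA : 0 < A)
    (hs : s < 4) :
    ((Ideal.absNorm (Ideal.span {α}) / Ideal.absNorm 𝔟 : ℕ) : ℝ) ^ (-s) *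
      wt A (realPair φ₁ φ₂ α) = (Ideal.absNorm 𝔟 : ℝ) ^ s * (A⁻¹ - A) *
        (kern A 1 s (realPair φ₁ φ₂ α) + kern A (-1) s (realPair φ₁ φ₂ α)) := by
  rcases eq_or_ne α 0 with rfl | h0
  · simp [wt_zero, kern_zero]
  have hz : (realPair φ₁ φ₂ α).1 * (realPair φ₁ φ₂ α).2 ≠ 0 := by simp [realPair_apply, h0]
  rw [mul_assoc, ← wt_mul_rpow hA hs hz, realPair_apply, mul_eq_norm hφ]
  have hdvd : Ideal.absNorm 𝔟 ∣ Ideal.absNorm (Ideal.span {α}) :=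
    Ideal.absNorm_dvd_absNorm_of_le ((Ideal.span_singleton_le_iff_mem _).2 hα)
  have h1 : ((Ideal.absNorm (Ideal.span {α}) : ℕ) : ℝ) = |(Algebra.norm ℤ α : ℝ)| := by
    rw [Ideal.absNorm_span_singleton, Nat.cast_natAbs, Int.cast_abs]
  have hN : 0 ≤ (Ideal.absNorm 𝔟 : ℝ) := Nat.cast_nonneg _
  rw [Nat.cast_div_charZero hdvd, h1, Real.div_rpow (abs_nonneg _) hN, Real.rpow_neg hN,
    div_inv_eq_mul]
  ring

open Classical in
lemma ite_mem_mul_wt (hφ : ∀ x, φ₁ x * φ₂ x = Algebra.norm ℚ x)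
    {n : ℕ} (η : DirichletCharacter ℂ n) (𝔟 : Ideal (𝓞 K)) {A s : ℝ}
    (hA : 0 < A) (hs : s < 4) (α : 𝓞 K) :
    (if α ∈ 𝔟 then
      η ((Ideal.absNorm (Ideal.span {α}) / Ideal.absNorm 𝔟 : ℕ) : ZMod n) *
      (((Ideal.absNorm (Ideal.span {α}) / Ideal.absNorm 𝔟 : ℕ) : ℝ) ^ (-s) : ℝ) *
        wt A (realPair φ₁ φ₂ α) else 0) =
    ((Ideal.absNorm 𝔟 : ℝ) ^ s * (A⁻¹ - A) : ℝ) *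
      (normChar η 𝔟 1 α * kern A (1 : ℤ) s (realPair φ₁ φ₂ α) +
       normChar η 𝔟 (-1) α * kern A (-1 : ℤ) s (realPair φ₁ φ₂ α)) := by
  by_cases hα : α ∈ 𝔟
  · rw [if_pos hα, mul_assoc, ← Complex.ofReal_mul, absNorm_div_rpow_mul_wt hφ hα hA hs,
      ← char_mul_kern hφ η hα (Or.inl rfl) hs, ← char_mul_kern hφ η hα (Or.inr rfl) hs]
    push_cast
    ring
  · simp [normChar, hα]

lemma summable_normChar_mul_kern (hφ : ∀ x, φ₁ x * φ₂ x = Algebra.norm ℚ x)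
    (h2 : finrank ℚ K = 2) {n : ℕ} (η : DirichletCharacter ℂ n)
    (𝔟 : Ideal (𝓞 K)) {A : ℝ} (hA : 0 < A) (hA1 : A < 1) {κ : ℤ} (hκ : |(κ : ℝ)| = 1)
    {s : ℝ} (hs : 1 < s) (hs2 : s ≤ 2) :
    Summable fun α => normChar η 𝔟 κ α * (kern A κ s (realPair φ₁ φ₂ α) : ℂ) := by
  refine Summable.of_norm_bounded (summable_kern _ (one_le_norm_realPair hφ)
    (summable_realPair hφ h2) hA hA1 hκ hs hs2) fun α => ?_
  rw [norm_mul, Complex.norm_real, Real.norm_of_nonneg (kern_nonneg hA _ _)]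
  exact mul_le_of_le_one_left (kern_nonneg hA _ _) (norm_normChar_le _ _ _ _)

end Quadratic

section Quadratic
variable {K : Type*} [Field K] [NumberField K]

lemma summable_class [IsTotallyReal K] (h2 : finrank ℚ K = 2) (𝔟 : (Ideal (𝓞 K))⁰)
    {s : ℝ} (hs : 1 < s) (hs2 : s ≤ 2) :
    Summable fun 𝔞 : {𝔞 : (Ideal (𝓞 K))⁰ // ClassGroup.mk0 𝔞 * ClassGroup.mk0 𝔟 = 1} =>
      (Ideal.absNorm (𝔞 : Ideal (𝓞 K)) : ℝ) ^ (-s) := by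
  classical
  obtain ⟨φ₁, φ₂, hφ⟩ := exists_real_embeddings h2
  obtain ⟨ε, hε1, hε⟩ := exists_fundamental_unit h2 φ₁
  have hA : 0 < φ₁ (ε : 𝓞 K) ^ 4 := by
    have : φ₁ (ε : 𝓞 K) ≠ 0 := by simp
    positivity
  have hA1 : φ₁ (ε : 𝓞 K) ^ 4 < 1 := by
    rw [← Even.pow_abs (by decide)]
    exact pow_lt_one₀ (abs_nonneg _) hε1 (by norm_num)
  have hs' := ((summable_normChar_mul_kern hφ h2 (1 : DirichletCharacter ℂ 1) (𝔟 : Ideal (𝓞 K))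
    hA hA1 (κ := 1) (by simp) hs hs2).add (summable_normChar_mul_kern hφ h2
    (1 : DirichletCharacter ℂ 1) (𝔟 : Ideal (𝓞 K)) hA hA1 (κ := -1) (by simp) hs hs2)).mul_left
    ((((Ideal.absNorm (𝔟 : Ideal (𝓞 K)) : ℝ) ^ s *
      ((φ₁ (ε : 𝓞 K) ^ 4)⁻¹ - φ₁ (ε : 𝓞 K) ^ 4) : ℝ) : ℂ))
  have h := hasSum_class hφ hε1 hε 𝔟 (fun I =>
    (1 : DirichletCharacter ℂ 1)
      ((Ideal.absNorm I / Ideal.absNorm (𝔟 : Ideal (𝓞 K)) : ℕ) : ZMod 1) *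
      (((Ideal.absNorm I / Ideal.absNorm (𝔟 : Ideal (𝓞 K)) : ℕ) : ℝ) ^ (-s) : ℝ))
    (hs'.congr fun α => (ite_mem_mul_wt (s := s) hφ 1 _ hA (by linarith) α).symm)
  have hcard : (Nat.card (Units.torsion K) : ℂ) ≠ 0 := Nat.cast_ne_zero.2 Nat.card_pos.ne'
  have h3 := ((summable_mul_right_iff hcard).1 h.summable).norm
  refine h3.congr fun 𝔞 => ?_
  have hN : 0 < Ideal.absNorm (𝔟 : Ideal (𝓞 K)) :=
    Nat.pos_of_ne_zero (Ideal.absNorm_eq_zero_iff.not.2 (nonZeroDivisors.ne_zero 𝔟.2))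
  rw [map_mul, Nat.mul_div_cancel _ hN, MulChar.one_apply (isUnit_of_subsingleton _), one_mul,
    Complex.norm_real, Real.norm_of_nonneg (by positivity)]

open Classical in
lemma exists_class_bound [IsTotallyReal K] (h2 : finrank ℚ K = 2) (𝔟 : (Ideal (𝓞 K))⁰)
    {n : ℕ} (η : DirichletCharacter ℂ n) {𝔠 : Ideal (𝓞 K)} (h𝔠 : 𝔠 ≠ ⊥)
    (hcop : IsCoprime (Ideal.span {((n * Ideal.absNorm (𝔟 : Ideal (𝓞 K)) : ℕ) : 𝓞 K)}) 𝔠) :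
    ∃ B : ℝ, ∀ s : ℝ, 1 < s → s ≤ 2 →
      ‖∑' 𝔞 : {𝔞 : (Ideal (𝓞 K))⁰ // ClassGroup.mk0 𝔞 * ClassGroup.mk0 𝔟 = 1},
        ((if 𝔠 ∣ (𝔞 : Ideal (𝓞 K)) then 1 else 0) - (Ideal.absNorm 𝔠 : ℂ)⁻¹) *
        (η (Ideal.absNorm (𝔞 : Ideal (𝓞 K)) : ZMod n) *
          ((Ideal.absNorm (𝔞 : Ideal (𝓞 K)) : ℝ) ^ (-s) : ℝ))‖ ≤ B := by
  obtain ⟨φ₁, φ₂, hφ⟩ := exists_real_embeddings h2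
  obtain ⟨ε, hε1, hε⟩ := exists_fundamental_unit h2 φ₁
  set A := φ₁ (ε : 𝓞 K) ^ 4 with hAdef
  have hA : 0 < A := by
    have : φ₁ (ε : 𝓞 K) ≠ 0 := by simp
    positivity
  have hA1 : A < 1 := by
    rw [hAdef, ← Even.pow_abs (by decide)]
    exact pow_lt_one₀ (abs_nonneg _) hε1 (by norm_num)
  have h𝔟 : (𝔟 : Ideal (𝓞 K)) ≠ ⊥ := nonZeroDivisors.ne_zero 𝔟.2
  set N := Ideal.absNorm (𝔟 : Ideal (𝓞 K)) with hNdef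
  have hN : 0 < N := Nat.pos_of_ne_zero (Ideal.absNorm_eq_zero_iff.not.2 h𝔟)
  have hdvd {I : Ideal (𝓞 K)} : (𝔟 : Ideal (𝓞 K)) * 𝔠 ∣ I * 𝔟 ↔ 𝔠 ∣ I := by
    rw [mul_comm I, mul_dvd_mul_iff_left h𝔟]
  have hmem {α : 𝓞 K} (hα : α ∈ (𝔟 : Ideal (𝓞 K))) :
      (𝔟 : Ideal (𝓞 K)) * 𝔠 ∣ Ideal.span {α} ↔ α ∈ 𝔠 := by
    have hb : IsCoprime (𝔟 : Ideal (𝓞 K)) 𝔠 := by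
      rw [Ideal.isCoprime_iff_sup_eq, eq_top_iff, ← hcop.sup_eq]
      refine sup_le_sup_right ((Ideal.span_singleton_le_iff_mem _).2 ?_) _
      rw [Nat.cast_mul]
      exact Ideal.mul_mem_left _ _ (Ideal.absNorm_mem _)
    rw [Ideal.dvd_span_singleton, Ideal.mul_eq_inf_of_isCoprime hb]
    exact ⟨fun h => h.2, fun h => ⟨hα, h⟩⟩
  obtain ⟨B₁, hB₁⟩ := norm_tsum_normChar_le hφ h2 η hA hA1 (κ := 1) (by simp) h𝔟 h𝔠 hcop
  obtain ⟨B₂, hB₂⟩ := norm_tsum_normChar_le hφ h2 η hA hA1 (κ := -1) (by simp) h𝔟 h𝔠 hcop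
  refine ⟨(N : ℝ) ^ (2 : ℝ) * (A⁻¹ - A) * (B₁ + B₂), fun s hs hs2 => ?_⟩
  have hk : ‖(Ideal.absNorm 𝔠 : ℂ)⁻¹‖ ≤ 1 := by
    rw [norm_inv, Complex.norm_natCast]
    exact inv_le_one_of_one_le₀ (Nat.one_le_cast.2 (Nat.pos_of_ne_zero
      (Ideal.absNorm_eq_zero_iff.not.2 h𝔠)))
  have hw : ∀ P : Prop, ‖(if P then (1 : ℂ) else 0) - (Ideal.absNorm 𝔠 : ℂ)⁻¹‖ ≤ 2 := fun P =>
    (norm_sub_le _ _).trans (by split_ifs <;> simp only [norm_one, norm_zero] <;> linarith)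
  have hsum (κ : ℤ) (hκ : |(κ : ℝ)| = 1) : Summable fun α =>
      ((if α ∈ 𝔠 then (1 : ℂ) else 0) - (Ideal.absNorm 𝔠 : ℂ)⁻¹) *
        (normChar η 𝔟 κ α * (kern A κ s (realPair φ₁ φ₂ α) : ℂ)) :=
    Summable.of_norm_bounded
      ((summable_normChar_mul_kern hφ h2 η 𝔟 hA hA1 hκ hs hs2).norm.mul_left 2) fun α => by
        rw [norm_mul]
        exact mul_le_mul_of_nonneg_right (hw _) (norm_nonneg _)
  have h1 := hsum 1 (by simp)
  have h3 := hsum (-1) (by simp)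
  have hterm (α : 𝓞 K) : (if α ∈ (𝔟 : Ideal (𝓞 K)) then
      ((if (𝔟 : Ideal (𝓞 K)) * 𝔠 ∣ Ideal.span {α} then (1 : ℂ) else 0) -
        (Ideal.absNorm 𝔠 : ℂ)⁻¹) *
      (η ((Ideal.absNorm (Ideal.span {α}) / N : ℕ) : ZMod n) *
        (((Ideal.absNorm (Ideal.span {α}) / N : ℕ) : ℝ) ^ (-s) : ℝ)) *
          wt A (realPair φ₁ φ₂ α) else 0) =
      ((N : ℝ) ^ s * (A⁻¹ - A) : ℝ) *
        (((if α ∈ 𝔠 then (1 : ℂ) else 0) - (Ideal.absNorm 𝔠 : ℂ)⁻¹) *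
          (normChar η 𝔟 1 α * (kern A (1 : ℤ) s (realPair φ₁ φ₂ α) : ℂ)) +
        ((if α ∈ 𝔠 then (1 : ℂ) else 0) - (Ideal.absNorm 𝔠 : ℂ)⁻¹) *
          (normChar η 𝔟 (-1) α * (kern A (-1 : ℤ) s (realPair φ₁ φ₂ α) : ℂ))) := by
    have := ite_mem_mul_wt (s := s) hφ η (𝔟 : Ideal (𝓞 K)) hA (by linarith) α
    rw [← mul_add, mul_left_comm (Complex.ofReal _), hNdef, ← this]
    split_ifs with hα h4 h5 h5
    · ring
    · exact absurd ((hmem hα).1 h4) h5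
    · exact absurd ((hmem hα).2 h5) h4
    · ring
    · simp
    · simp
  have h := hasSum_class hφ hε1 hε 𝔟 (fun I =>
    ((if (𝔟 : Ideal (𝓞 K)) * 𝔠 ∣ I then (1 : ℂ) else 0) - (Ideal.absNorm 𝔠 : ℂ)⁻¹) *
      (η ((Ideal.absNorm I / N : ℕ) : ZMod n) * (((Ideal.absNorm I / N : ℕ) : ℝ) ^ (-s) : ℝ)))
    (((h1.add h3).mul_left _).congr fun α => (hterm α).symm)
  have hcard : (1 : ℝ) ≤ ‖(Nat.card (Units.torsion K) : ℂ)‖ := by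
    rw [Complex.norm_natCast]
    exact Nat.one_le_cast.2 Nat.card_pos
  refine (le_mul_of_one_le_right (norm_nonneg _) hcard).trans ?_
  rw [← norm_mul, ← tsum_mul_right]
  have h4 := h.tsum_eq
  simp only [hdvd, map_mul, ← hNdef, Nat.mul_div_cancel _ hN] at h4
  rw [h4, tsum_congr hterm, tsum_mul_left, h1.tsum_add h3, norm_mul, Complex.norm_real]
  have hAA : 0 ≤ A⁻¹ - A := sub_nonneg.2 (hA1.le.trans (one_le_inv_iff₀.2 ⟨hA, hA1.le⟩))
  rw [Real.norm_of_nonneg (by positivity)]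
  refine mul_le_mul (mul_le_mul_of_nonneg_right
    (Real.rpow_le_rpow_of_exponent_le (Nat.one_le_cast.2 hN) hs2) hAA)
    ((norm_add_le _ _).trans (add_le_add (hB₁ s hs hs2) (hB₂ s hs hs2))) (norm_nonneg _)
    (by positivity)

end Quadratic

section Twist
variable {K : Type*} [Field K] [NumberField K]

/-- The character `𝔞 ↦ ψ([𝔞]) η(N𝔞)` of the monoid of nonzero ideals. -/
noncomputable def twist (ψ : ClassGroup (𝓞 K) →* ℂˣ) {n : ℕ} (η : DirichletCharacter ℂ n) :
    (Ideal (𝓞 K))⁰ →* ℂ where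
  toFun 𝔞 := ψ (ClassGroup.mk0 𝔞) * η (Ideal.absNorm (𝔞 : Ideal (𝓞 K)) : ZMod n)
  map_one' := by simp
  map_mul' 𝔞 𝔟 := by
    simp only [map_mul, Units.val_mul, Submonoid.coe_mul, Nat.cast_mul]
    ring

lemma twist_apply (ψ : ClassGroup (𝓞 K) →* ℂˣ) {n : ℕ} (η : DirichletCharacter ℂ n)
    (𝔞 : (Ideal (𝓞 K))⁰) :
    twist ψ η 𝔞 = ψ (ClassGroup.mk0 𝔞) * η (Ideal.absNorm (𝔞 : Ideal (𝓞 K)) : ZMod n) := rfl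

lemma norm_classGroup_char (ψ : ClassGroup (𝓞 K) →* ℂˣ) (c : ClassGroup (𝓞 K)) :
    ‖(ψ c : ℂ)‖ = 1 := by
  refine Complex.norm_eq_one_of_pow_eq_one (n := Fintype.card (ClassGroup (𝓞 K))) ?_
    Fintype.card_ne_zero
  rw [← Units.val_pow_eq_pow_val, ← map_pow, pow_card_eq_one, map_one, Units.val_one]

lemma norm_twist_le (ψ : ClassGroup (𝓞 K) →* ℂˣ) {n : ℕ} (η : DirichletCharacter ℂ n)
    (𝔞 : (Ideal (𝓞 K))⁰) : ‖twist ψ η 𝔞‖ ≤ 1 := by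
  rw [twist_apply, norm_mul, norm_classGroup_char, one_mul]
  exact η.norm_le_one _

lemma absNorm_pos (𝔞 : (Ideal (𝓞 K))⁰) : 0 < Ideal.absNorm (𝔞 : Ideal (𝓞 K)) :=
  Nat.pos_of_ne_zero (Ideal.absNorm_eq_zero_iff.not.2 (nonZeroDivisors.ne_zero 𝔞.2))

lemma coprime_absNorm {M : ℕ} {𝔠 : Ideal (𝓞 K)}
    (h : IsCoprime (Ideal.span {(M : 𝓞 K)}) 𝔠) : (Ideal.absNorm 𝔠).Coprime M := by
  obtain ⟨x, hx, y, hy, hxy⟩ := Ideal.isCoprime_iff_exists.1 h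
  obtain ⟨z, rfl⟩ := Ideal.mem_span_singleton.1 hx
  obtain ⟨t, ht⟩ := dvd_norm_add_natCast_mul_sub M y z
  rw [add_comm, hxy, map_one] at ht
  obtain ⟨u, hu⟩ := Ideal.absNorm_dvd_norm_of_mem hy
  rw [hu] at ht
  exact Nat.isCoprime_iff_coprime.1 ⟨u, t, by linarith⟩

lemma exists_mk0_eq_isCoprime (c : ClassGroup (𝓞 K)) {M : ℕ} (hM : M ≠ 0) :
    ∃ 𝔠 : (Ideal (𝓞 K))⁰, ClassGroup.mk0 𝔠 = c ∧
      IsCoprime (Ideal.span {(M : 𝓞 K)}) (𝔠 : Ideal (𝓞 K)) := by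
  obtain ⟨𝔟, h𝔟⟩ := ClassGroup.mk0_surjective c⁻¹
  have h𝔟0 : (𝔟 : Ideal (𝓞 K)) ≠ 0 := nonZeroDivisors.ne_zero 𝔟.2
  have hM0 : Ideal.span {((2 * M : ℕ) : 𝓞 K)} ≠ 0 := by
    simpa [Ideal.span_singleton_eq_bot] using hM
  obtain ⟨a, ha⟩ := IsDedekindDomain.exists_sup_span_eq
    (I := Ideal.span {((2 * M : ℕ) : 𝓞 K)} * (𝔟 : Ideal (𝓞 K))) (J := (𝔟 : Ideal (𝓞 K)))
    Ideal.mul_le_right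
    (mul_ne_zero hM0 h𝔟0)
  obtain ⟨𝔠, h𝔠⟩ : (𝔟 : Ideal (𝓞 K)) ∣ Ideal.span {a} := by
    rw [Ideal.dvd_iff_le]
    exact le_sup_right.trans ha.le
  have hcop : Ideal.span {((2 * M : ℕ) : 𝓞 K)} ⊔ 𝔠 = ⊤ := by
    rw [h𝔠, mul_comm (𝔟 : Ideal (𝓞 K)), ← Ideal.sup_mul] at ha
    rw [← Ideal.one_eq_top]
    exact mul_right_cancel₀ h𝔟0 (ha.trans (one_mul _).symm)
  have h𝔠0 : 𝔠 ≠ 0 := by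
    rintro rfl
    rw [Submodule.zero_eq_bot, sup_bot_eq] at hcop
    have := congrArg Ideal.absNorm hcop
    rw [Ideal.absNorm_span_natCast, Ideal.absNorm_top, Nat.pow_eq_one,
      or_iff_left Module.finrank_pos.ne'] at this
    omega
  have ha0 : a ≠ 0 := by
    rintro rfl
    rw [Ideal.span_singleton_zero] at h𝔠
    exact mul_ne_zero h𝔟0 h𝔠0 h𝔠.symm
  refine ⟨⟨𝔠, mem_nonZeroDivisors_of_ne_zero h𝔠0⟩, ?_, ?_⟩
  · refine inv_injective (Eq.symm ?_)
    rw [← h𝔟, eq_inv_iff_mul_eq_one, ← map_mul, ClassGroup.mk0_eq_one_iff]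
    exact ⟨⟨a, h𝔠.symm⟩⟩
  · rw [Ideal.isCoprime_iff_sup_eq, eq_top_iff, ← hcop]
    refine sup_le_sup_right ((Ideal.span_singleton_le_iff_mem _).2 ?_) _
    exact Ideal.mem_span_singleton.2 ⟨2, by push_cast; ring⟩

lemma exists_twist_ne_one (h2 : finrank ℚ K = 2) {ψ : ClassGroup (𝓞 K) →* ℂˣ}
    (hψ : ∃ c, ψ c ^ 2 ≠ 1) {n : ℕ} (η : DirichletCharacter ℂ n) {M : ℕ} (hM : M ≠ 0)
    (hn : n ∣ M) :
    ∃ 𝔠 : (Ideal (𝓞 K))⁰, IsCoprime (Ideal.span {(M : 𝓞 K)}) (𝔠 : Ideal (𝓞 K)) ∧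
      twist ψ η 𝔠 ≠ 1 := by
  by_cases hη : η ^ 2 = 1
  · obtain ⟨c, hc⟩ := hψ
    obtain ⟨𝔠, h𝔠, hcop⟩ := exists_mk0_eq_isCoprime c hM
    refine ⟨𝔠, hcop, fun h => hc ?_⟩
    have hu := (ZMod.isUnit_iff_coprime _ n).2 ((coprime_absNorm hcop).coprime_dvd_right hn)
    have h1 := congrArg (· ^ 2) h
    simp only [twist_apply, mul_pow, one_pow] at h1
    rw [← MulChar.pow_apply' η two_ne_zero, hη, MulChar.one_apply hu, mul_one, h𝔠] at h1
    exact Units.ext h1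
  · obtain ⟨u, hu⟩ := MulChar.ne_one_iff.1 hη
    have : NeZero M := ⟨hM⟩
    obtain ⟨v, rfl⟩ := ZMod.unitsMap_surjective hn u
    obtain ⟨a, ha0, hcop, ha⟩ : ∃ a : ℕ, a ≠ 0 ∧ M.Coprime a ∧
        (a : ZMod n) = (ZMod.unitsMap hn v : (ZMod n)ˣ) := by
      refine ⟨(v : ZMod M).val + M, by omega, ?_, ?_⟩
      · simpa using (ZMod.val_coe_unit_coprime v).symm
      · rw [Nat.cast_add, (ZMod.natCast_eq_zero_iff M n).2 hn, add_zero, ZMod.natCast_val,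
          ZMod.unitsMap_val]
    refine ⟨⟨Ideal.span {(a : 𝓞 K)}, mem_nonZeroDivisors_of_ne_zero ?_⟩, ?_, fun h => hu ?_⟩
    · simpa [Ideal.span_singleton_eq_bot] using ha0
    · rw [Ideal.isCoprime_span_singleton_iff]
      simpa using (Nat.isCoprime_iff_coprime.2 hcop).map (Int.castRingHom (𝓞 K))
    · rw [twist_apply, (ClassGroup.mk0_eq_one_iff _).2 ⟨⟨_, rfl⟩⟩, map_one, Units.val_one,
        one_mul, Ideal.absNorm_span_natCast, RingOfIntegers.rank, h2, Nat.cast_pow, map_pow] at h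
      rw [MulChar.pow_apply' η two_ne_zero, ← ha, h]

end Twist

section Bounded
variable {K : Type*} [Field K] [NumberField K]

lemma exists_mk0_eq_iff (c : ClassGroup (𝓞 K)) : ∃ 𝔟 : (Ideal (𝓞 K))⁰,
    (fun 𝔞 : (Ideal (𝓞 K))⁰ => ClassGroup.mk0 𝔞 * ClassGroup.mk0 𝔟 = 1) =
      fun 𝔞 => ClassGroup.mk0 𝔞 = c := by
  obtain ⟨𝔟, h𝔟⟩ := ClassGroup.mk0_surjective c⁻¹
  exact ⟨𝔟, funext fun 𝔞 => by rw [h𝔟, mul_inv_eq_one]⟩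

variable [IsTotallyReal K]

lemma summable_absNorm_rpow (h2 : finrank ℚ K = 2) {s : ℝ} (hs : 1 < s) (hs2 : s ≤ 2) :
    Summable fun 𝔞 : (Ideal (𝓞 K))⁰ => (Ideal.absNorm (𝔞 : Ideal (𝓞 K)) : ℝ) ^ (-s) := by
  rw [← (Equiv.sigmaFiberEquiv (ClassGroup.mk0 (R := 𝓞 K))).summable_iff]
  refine (summable_sigma_of_nonneg fun _ => Real.rpow_nonneg (Nat.cast_nonneg _) _).2
    ⟨fun c => ?_, (hasSum_fintype _).summable⟩
  obtain ⟨𝔟, h𝔟⟩ := exists_mk0_eq_iff c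
  have h := summable_class h2 𝔟 hs hs2
  rw [h𝔟] at h
  exact h

lemma summable_twist (h2 : finrank ℚ K = 2)
    (ψ : ClassGroup (𝓞 K) →* ℂˣ) {n : ℕ} (η : DirichletCharacter ℂ n)
    {s : ℝ} (hs : 1 < s) (hs2 : s ≤ 2) :
    Summable fun 𝔞 : (Ideal (𝓞 K))⁰ =>
      twist ψ η 𝔞 * ((Ideal.absNorm (𝔞 : Ideal (𝓞 K)) : ℝ) ^ (-s) : ℝ) :=
  Summable.of_norm_bounded (summable_absNorm_rpow h2 hs hs2) fun 𝔞 => by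
    rw [norm_mul, Complex.norm_real, Real.norm_of_nonneg (by positivity)]
    exact mul_le_of_le_one_left (by positivity) (norm_twist_le ψ η 𝔞)

open Classical in
lemma exists_sum_classes_bound (h2 : finrank ℚ K = 2)
    (ψ : ClassGroup (𝓞 K) →* ℂˣ) {n : ℕ} (η : DirichletCharacter ℂ n)
    (𝔟 : ClassGroup (𝓞 K) → (Ideal (𝓞 K))⁰)
    (h𝔟 : ∀ c, (fun 𝔞 : (Ideal (𝓞 K))⁰ => ClassGroup.mk0 𝔞 * ClassGroup.mk0 (𝔟 c) = 1) =
      fun 𝔞 => ClassGroup.mk0 𝔞 = c)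
    {𝔠 : Ideal (𝓞 K)} (h𝔠 : 𝔠 ≠ ⊥)
    (hcop : ∀ c,
      IsCoprime (Ideal.span {((n * Ideal.absNorm (𝔟 c : Ideal (𝓞 K)) : ℕ) : 𝓞 K)}) 𝔠) :
    ∃ B : ℝ, ∀ s : ℝ, 1 < s → s ≤ 2 →
      ‖∑' 𝔞 : (Ideal (𝓞 K))⁰,
        ((if 𝔠 ∣ (𝔞 : Ideal (𝓞 K)) then 1 else 0) - (Ideal.absNorm 𝔠 : ℂ)⁻¹) *
        (twist ψ η 𝔞 * ((Ideal.absNorm (𝔞 : Ideal (𝓞 K)) : ℝ) ^ (-s) : ℝ))‖ ≤ B := by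
  choose B hB using fun c => exists_class_bound h2 (𝔟 c) η h𝔠 (hcop c)
  refine ⟨∑ c, B c, fun s hs hs2 => ?_⟩
  have hsum : Summable fun 𝔞 : (Ideal (𝓞 K))⁰ =>
      ((if 𝔠 ∣ (𝔞 : Ideal (𝓞 K)) then (1 : ℂ) else 0) - (Ideal.absNorm 𝔠 : ℂ)⁻¹) *
        (twist ψ η 𝔞 * ((Ideal.absNorm (𝔞 : Ideal (𝓞 K)) : ℝ) ^ (-s) : ℝ)) := by
    refine Summable.of_norm_bounded ((summable_twist h2 ψ η hs hs2).norm.mul_left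
      (1 + ‖(Ideal.absNorm 𝔠 : ℂ)⁻¹‖)) fun 𝔞 => ?_
    rw [norm_mul]
    refine mul_le_mul_of_nonneg_right ((norm_sub_le _ _).trans ?_) (norm_nonneg _)
    split_ifs <;> simp
  have hsum' := ((Equiv.sigmaFiberEquiv (ClassGroup.mk0 (R := 𝓞 K))).summable_iff.2 hsum).tsum_sigma
  rw [Function.comp_def] at hsum'
  rw [← (Equiv.sigmaFiberEquiv (ClassGroup.mk0 (R := 𝓞 K))).tsum_eq, hsum', tsum_fintype]
  refine norm_sum_le_of_le _ fun c _ => ?_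
  have h := hB c s hs hs2
  rw [h𝔟 c] at h
  refine le_of_eq_of_le (Eq.symm ?_) h
  rw [← one_mul ‖_‖, ← norm_classGroup_char ψ c, ← norm_mul, ← tsum_mul_left]
  refine congrArg _ (tsum_congr fun 𝔞 => ?_)
  simp only [Equiv.sigmaFiberEquiv_apply, twist_apply, 𝔞.2]
  ring

lemma exists_norm_tsum_twist_le (h2 : finrank ℚ K = 2)
    {ψ : ClassGroup (𝓞 K) →* ℂˣ} (hψ : ∃ c, ψ c ^ 2 ≠ 1)
    {n : ℕ} (hn : n ≠ 0) (η : DirichletCharacter ℂ n) :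
    ∃ B : ℝ, ∀ s : ℝ, 1 < s → s ≤ 2 → ‖∑' 𝔞 : (Ideal (𝓞 K))⁰,
      twist ψ η 𝔞 * ((Ideal.absNorm (𝔞 : Ideal (𝓞 K)) : ℝ) ^ (-s) : ℝ)‖ ≤ B := by
  classical
  choose 𝔟 h𝔟 using exists_mk0_eq_iff (K := K)
  set M := n * ∏ c, Ideal.absNorm (𝔟 c : Ideal (𝓞 K)) with hM
  have hM0 : M ≠ 0 := mul_ne_zero hn (Finset.prod_ne_zero_iff.2 fun c _ => (absNorm_pos _).ne')
  obtain ⟨𝔠, hcop, h𝔠⟩ := exists_twist_ne_one h2 hψ η hM0 ⟨_, hM⟩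
  have h𝔠0 : (𝔠 : Ideal (𝓞 K)) ≠ ⊥ := nonZeroDivisors.ne_zero 𝔠.2
  obtain ⟨B, hB⟩ := exists_sum_classes_bound h2 ψ η 𝔟 h𝔟 h𝔠0 fun c => by
    refine hcop.of_isCoprime_of_dvd_left (Ideal.dvd_iff_le.2 ?_)
    rw [Ideal.span_singleton_le_span_singleton]
    exact_mod_cast Nat.cast_dvd_cast (mul_dvd_mul_left n
      (Finset.dvd_prod_of_mem (fun c => Ideal.absNorm (𝔟 c : Ideal (𝓞 K))) (Finset.mem_univ c)))
  set k := Ideal.absNorm (𝔠 : Ideal (𝓞 K)) with hk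
  have hk0 : 0 < k := absNorm_pos 𝔠
  set w : ℝ → ℂ := fun s => twist ψ η 𝔠 * ((k : ℝ) ^ (-s) : ℝ) - (k : ℂ)⁻¹ with hw
  have hnorm : ‖twist ψ η 𝔠‖ = 1 := by
    have hu := (ZMod.isUnit_iff_coprime _ n).2
      ((coprime_absNorm hcop).coprime_dvd_right ⟨_, hM⟩)
    rw [twist_apply, norm_mul, norm_classGroup_char, one_mul]
    obtain ⟨u, hu⟩ := hu
    rw [← hu]
    exact η.unit_norm_eq_one u
  have hwne : ∀ s ∈ Set.Icc (1 : ℝ) 2, w s ≠ 0 := by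
    intro s hs h
    have h := sub_eq_zero.1 h
    have h1 := congrArg norm h
    rw [norm_mul, hnorm, one_mul, Complex.norm_real, Real.norm_of_nonneg (by positivity),
      norm_inv, Complex.norm_natCast, ← Real.rpow_neg_one] at h1
    rcases eq_or_ne k 1 with hk1 | hk1
    · rw [hk1] at h
      exact h𝔠 (by simpa using h)
    · have hk2 : (1 : ℝ) < k := by exact_mod_cast lt_of_le_of_ne hk0 hk1.symm
      rw [h1, Real.rpow_neg_one, Complex.ofReal_inv, Complex.ofReal_natCast] at h
      exact h𝔠 (mul_right_cancel₀ (inv_ne_zero (Nat.cast_ne_zero.2 hk0.ne'))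
        (h.trans (one_mul _).symm))
  have hcont : ContinuousOn (fun s => ‖w s‖) (Set.Icc 1 2) := by
    refine Continuous.continuousOn (continuous_norm.comp ((continuous_const.mul
      (Complex.continuous_ofReal.comp ?_)).sub continuous_const))
    exact Real.continuous_const_rpow (Nat.cast_ne_zero.2 hk0.ne') |>.comp continuous_neg
  obtain ⟨s₀, hs₀, hmin⟩ := isCompact_Icc.exists_isMinOn (Set.nonempty_Icc.2 one_le_two) hcont
  have hδ : 0 < ‖w s₀‖ := norm_pos_iff.2 (hwne s₀ hs₀)
  refine ⟨B / ‖w s₀‖, fun s hs hs2 => ?_⟩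
  rw [le_div_iff₀ hδ]
  refine (mul_le_mul_of_nonneg_left (hmin ⟨hs.le, hs2⟩) (norm_nonneg _)).trans ?_
  refine le_of_eq_of_le ?_ (hB s hs hs2)
  have hZ := summable_twist h2 ψ η hs hs2
  have hinj : Function.Injective fun 𝔞 : (Ideal (𝓞 K))⁰ => 𝔠 * 𝔞 := mul_right_injective 𝔠
  have hmul : HasSum (fun 𝔞 : (Ideal (𝓞 K))⁰ => if (𝔠 : Ideal (𝓞 K)) ∣ (𝔞 : Ideal (𝓞 K)) then
      twist ψ η 𝔞 * ((Ideal.absNorm (𝔞 : Ideal (𝓞 K)) : ℝ) ^ (-s) : ℝ) else 0)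
      (twist ψ η 𝔠 * ((k : ℝ) ^ (-s) : ℝ) * ∑' 𝔞 : (Ideal (𝓞 K))⁰,
      twist ψ η 𝔞 * ((Ideal.absNorm (𝔞 : Ideal (𝓞 K)) : ℝ) ^ (-s) : ℝ)) := by
    refine (hinj.hasSum_iff fun 𝔞 h𝔞 => if_neg ?_).1
      ((hZ.hasSum.mul_left _).congr_fun fun 𝔞 => ?_)
    · rintro ⟨𝔡, h𝔡⟩
      have h0 : 𝔡 ≠ 0 := by
        rintro rfl
        exact nonZeroDivisors.ne_zero 𝔞.2 (h𝔡.trans (mul_zero _))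
      exact h𝔞 ⟨⟨𝔡, mem_nonZeroDivisors_of_ne_zero h0⟩, Subtype.ext h𝔡.symm⟩
    · simp only [Function.comp_apply, Submonoid.coe_mul, dvd_mul_right, if_true, map_mul,
        Nat.cast_mul]
      rw [Real.mul_rpow (by positivity) (by positivity)]
      push_cast
      ring
  rw [mul_comm ‖tsum _‖, ← norm_mul]
  congr 1
  rw [hw, sub_mul]
  refine ((hmul.sub (hZ.hasSum.mul_left _)).congr_fun fun 𝔞 => ?_).tsum_eq.symm
  rw [sub_mul]
  split_ifs <;> ring

end Bounded

section Factorization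
open UniqueFactorizationMonoid

variable {α β : Type*} [CommMonoidWithZero α] [UniqueFactorizationMonoid α]
  [NormalizationMonoid α] [Subsingleton αˣ]
  [CommMonoidWithZero β] [UniqueFactorizationMonoid β] [NormalizationMonoid β] [Subsingleton βˣ]

open Classical in
/-- The multiplicative map that sends `0` to `0` and acts on the primes through `e`. -/
noncomputable def primeTransport (e : {p : α // Prime p} ≃ {p : β // Prime p}) (a : α) : β :=
  if a = 0 then 0 else
    ((normalizedFactors a).map fun p => if h : Prime p then (e ⟨p, h⟩ : β) else 1).prod

lemma primeTransport_symm_primeTransport [Nontrivial α] [Nontrivial β]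
    (e : {p : α // Prime p} ≃ {p : β // Prime p}) (a : α) :
    primeTransport e.symm (primeTransport e a) = a := by
  classical
  rcases eq_or_ne a 0 with rfl | ha
  · simp [primeTransport]
  have hprime : ∀ q ∈ (normalizedFactors a).map
      fun p => if h : Prime p then (e ⟨p, h⟩ : β) else 1, Prime q := by
    intro q hq
    obtain ⟨p, hp, rfl⟩ := Multiset.mem_map.1 hq
    rw [dif_pos (prime_of_normalized_factor p hp)]
    exact (e _).2
  have h0 : primeTransport e a ≠ 0 := by
    rw [primeTransport, if_neg ha]
    exact Multiset.prod_ne_zero fun h => (hprime 0 h).ne_zero rfl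
  rw [primeTransport, if_neg h0, primeTransport, if_neg ha,
    normalizedFactors_prod_of_prime hprime, Multiset.map_map]
  conv_rhs => rw [← associated_iff_eq.1 (prod_normalizedFactors ha),
    ← Multiset.map_id (normalizedFactors a)]
  refine congrArg _ (Multiset.map_congr rfl fun p hp => ?_)
  have hp := prime_of_normalized_factor p hp
  simp [hp, (e ⟨p, hp⟩).2]

lemma exists_mulEquiv_of_primes [Nontrivial α] [Nontrivial β]
    (e : {p : α // Prime p} ≃ {p : β // Prime p}) :
    ∃ g : α ≃* β, ∀ p : {p : α // Prime p}, g p = e p := by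
  classical
  refine ⟨⟨⟨primeTransport e, primeTransport e.symm, primeTransport_symm_primeTransport e,
    primeTransport_symm_primeTransport e.symm⟩, fun a b => ?_⟩, fun p => ?_⟩
  · rcases eq_or_ne a 0 with rfl | ha
    · simp [primeTransport]
    rcases eq_or_ne b 0 with rfl | hb
    · simp [primeTransport]
    simp [primeTransport, ha, hb, normalizedFactors_mul]
  · change primeTransport e p = e p
    rw [primeTransport, if_neg p.2.ne_zero, ← Multiset.prod_singleton (p : α),
      normalizedFactors_prod_of_prime (by simpa using p.2)]
    simp [p.2]

end Factorization

section EulerProduct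
variable {K : Type*} [Field K] [NumberField K]

lemma countable_ideal : Countable (Ideal (𝓞 K)) := by
  rw [← Set.countable_univ_iff]
  refine (Set.countable_iUnion fun n : ℕ => (Ideal.finite_setOfPred_absNorm_eq n).countable).mono
    fun I _ => Set.mem_iUnion.2 ⟨Ideal.absNorm I, rfl⟩

lemma infinite_prime_ideal : Infinite {𝔭 : Ideal (𝓞 K) // Prime 𝔭} := by
  have h (p : Nat.Primes) : ∃ 𝔭 : Ideal (𝓞 K), Prime 𝔭 ∧ ((p : ℕ) : 𝓞 K) ∈ 𝔭 := by
    have hne : Ideal.span {((p : ℕ) : 𝓞 K)} ≠ ⊤ := by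
      rw [Ne, ← Ideal.absNorm_eq_one_iff, Ideal.absNorm_span_natCast, Nat.pow_eq_one,
        or_iff_left Module.finrank_pos.ne']
      exact p.2.ne_one
    obtain ⟨𝔭, h𝔭, hle⟩ := Ideal.exists_le_maximal _ hne
    have hmem := (Ideal.span_singleton_le_iff_mem _).1 hle
    refine ⟨𝔭, Ideal.prime_of_isPrime ?_ h𝔭.isPrime, hmem⟩
    rintro rfl
    exact p.2.ne_zero (by simpa using hmem)
  choose f hf hmem using h
  refine Infinite.of_injective (fun p => (⟨f p, hf p⟩ : {𝔭 : Ideal (𝓞 K) // Prime 𝔭}))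
    fun p q hpq => ?_
  by_contra hne
  have hcop := (Nat.coprime_primes p.2 q.2).2 fun h => hne (Subtype.ext h)
  have hpq : f p = f q := congrArg Subtype.val hpq
  refine (Ideal.isPrime_of_prime (hf p)).ne_top ((Ideal.eq_top_iff_one _).2 ?_)
  obtain ⟨u, v, huv⟩ := (Nat.isCoprime_iff_coprime.2 hcop).map (Int.castRingHom (𝓞 K))
  rw [← huv]
  refine Ideal.add_mem _ (Ideal.mul_mem_left _ _ ?_) (Ideal.mul_mem_left _ _ ?_)
  · simpa using hmem p
  · simpa [hpq] using hmem q

lemma exp_tsum_prime_ideals (F : (Ideal (𝓞 K))⁰ →* ℂ) (hF : Summable fun 𝔞 => ‖F 𝔞‖) :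
    Complex.exp (∑' 𝔭 : {𝔭 : Ideal (𝓞 K) // Prime 𝔭},
      -Complex.log (1 - F ⟨𝔭, mem_nonZeroDivisors_of_ne_zero 𝔭.2.ne_zero⟩)) = ∑' 𝔞, F 𝔞 := by
  classical
  have : Countable {𝔭 : Ideal (𝓞 K) // Prime 𝔭} := by
    have := countable_ideal (K := K)
    infer_instance
  have := infinite_prime_ideal (K := K)
  let e₀ : {p : ℕ // Prime p} ≃ Nat.Primes := Equiv.subtypeEquivRight fun p => Nat.prime_iff.symm
  have : Infinite {p : ℕ // Prime p} := e₀.infinite_iff.2 inferInstance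
  obtain ⟨e⟩ := nonempty_equiv_of_countable (α := {p : ℕ // Prime p})
    (β := {𝔭 : Ideal (𝓞 K) // Prime 𝔭})
  obtain ⟨g, hg⟩ := exists_mulEquiv_of_primes e
  let G : Ideal (𝓞 K) →*₀ ℂ :=
    { toFun := fun 𝔞 => if h : 𝔞 = 0 then 0 else F ⟨𝔞, mem_nonZeroDivisors_of_ne_zero h⟩
      map_zero' := by simp
      map_one' := by
        rw [dif_neg one_ne_zero]
        exact map_one F
      map_mul' := fun 𝔞 𝔟 => by
        rcases eq_or_ne 𝔞 0 with rfl | ha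
        · simp
        rcases eq_or_ne 𝔟 0 with rfl | hb
        · simp
        rw [dif_neg ha, dif_neg hb, dif_neg (mul_ne_zero ha hb), ← map_mul]
        rfl }
  have hG (𝔞 : (Ideal (𝓞 K))⁰) : G 𝔞 = F 𝔞 := dif_neg (nonZeroDivisors.ne_zero 𝔞.2)
  have hsupp : Function.support G ⊆ Set.range (Subtype.val : (Ideal (𝓞 K))⁰ → Ideal (𝓞 K)) := by
    intro 𝔞 h
    exact ⟨⟨𝔞, mem_nonZeroDivisors_of_ne_zero fun h0 => h (by rw [h0, map_zero])⟩, rfl⟩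
  have hGsum : Summable fun 𝔞 => ‖G 𝔞‖ := by
    refine (Subtype.val_injective.summable_iff fun 𝔞 h𝔞 => ?_).1
      (hF.congr fun 𝔞 => (congrArg norm (hG 𝔞)).symm)
    by_contra h
    exact h𝔞 (hsupp fun h0 => h (by rw [h0, norm_zero]))
  have h := EulerProduct.exp_tsum_primes_log_eq_tsum
    (f := G.comp g.toMonoidWithZeroHom) (g.toEquiv.summable_iff.2 hGsum)
  have h1 : ∑' n : ℕ, G (g n) = ∑' 𝔞, F 𝔞 := by
    rw [show ∑' n : ℕ, G (g n) = ∑' 𝔞, G 𝔞 from g.toEquiv.tsum_eq G,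
      ← Subtype.val_injective.tsum_eq hsupp]
    exact tsum_congr hG
  refine Eq.trans (congrArg _ ?_) (h.trans h1)
  rw [← e.tsum_eq, ← e₀.symm.tsum_eq]
  refine tsum_congr fun p => ?_
  rw [← hG]
  exact congrArg (fun 𝔭 => -Complex.log (1 - G 𝔭)) (hg (e₀.symm p)).symm

end EulerProduct

section PrimeSums
variable {K : Type*} [Field K]

/-- A prime ideal, seen as a nonzero ideal. -/
def primeToNonzero (𝔭 : {𝔭 : Ideal (𝓞 K) // Prime 𝔭}) : (Ideal (𝓞 K))⁰ :=
  ⟨𝔭, mem_nonZeroDivisors_of_ne_zero 𝔭.2.ne_zero⟩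

lemma primeToNonzero_injective : Function.Injective (primeToNonzero (K := K)) :=
  fun _ _ h => Subtype.ext (congrArg (fun 𝔞 : (Ideal (𝓞 K))⁰ => (𝔞 : Ideal (𝓞 K))) h)

variable [NumberField K]

lemma two_le_absNorm_of_prime (𝔭 : {𝔭 : Ideal (𝓞 K) // Prime 𝔭}) :
    2 ≤ Ideal.absNorm (𝔭 : Ideal (𝓞 K)) := by
  have h0 : Ideal.absNorm (𝔭 : Ideal (𝓞 K)) ≠ 0 := Ideal.absNorm_eq_zero_iff.not.2 𝔭.2.ne_zero
  have h1 : Ideal.absNorm (𝔭 : Ideal (𝓞 K)) ≠ 1 :=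
    Ideal.absNorm_eq_one_iff.not.2 (Ideal.isPrime_of_prime 𝔭.2).ne_top
  omega

/-- The character `𝔞 ↦ χ(𝔞) N𝔞⁻ˢ` of the monoid of nonzero ideals. -/
noncomputable def mulAbsNormRpow (χ : (Ideal (𝓞 K))⁰ →* ℂ) (s : ℝ) : (Ideal (𝓞 K))⁰ →* ℂ where
  toFun 𝔞 := χ 𝔞 * ((Ideal.absNorm (𝔞 : Ideal (𝓞 K)) : ℝ) ^ (-s) : ℝ)
  map_one' := by simp
  map_mul' 𝔞 𝔟 := by
    rw [map_mul, Submonoid.coe_mul, map_mul, Nat.cast_mul,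
      Real.mul_rpow (Nat.cast_nonneg _) (Nat.cast_nonneg _), Complex.ofReal_mul]
    ring

lemma mulAbsNormRpow_apply (χ : (Ideal (𝓞 K))⁰ →* ℂ) (s : ℝ) (𝔞 : (Ideal (𝓞 K))⁰) :
    mulAbsNormRpow χ s 𝔞 = χ 𝔞 * ((Ideal.absNorm (𝔞 : Ideal (𝓞 K)) : ℝ) ^ (-s) : ℝ) := rfl

lemma norm_mulAbsNormRpow_le {χ : (Ideal (𝓞 K))⁰ →* ℂ} (hχ : ∀ 𝔞, ‖χ 𝔞‖ ≤ 1) (s : ℝ)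
    (𝔞 : (Ideal (𝓞 K))⁰) :
    ‖mulAbsNormRpow χ s 𝔞‖ ≤ (Ideal.absNorm (𝔞 : Ideal (𝓞 K)) : ℝ) ^ (-s) := by
  rw [mulAbsNormRpow_apply, norm_mul, Complex.norm_real, Real.norm_of_nonneg (by positivity)]
  exact mul_le_of_le_one_left (by positivity) (hχ 𝔞)

lemma norm_neg_log_one_sub_sub_le {z : ℂ} (hz : ‖z‖ ≤ 1 / 2) :
    ‖-Complex.log (1 - z) - z‖ ≤ ‖z‖ ^ 2 := by
  have h := Complex.norm_log_one_add_sub_self_le (z := -z) (by rw [norm_neg]; linarith)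
  rw [← sub_eq_add_neg, norm_neg] at h
  rw [← norm_neg, neg_sub, sub_neg_eq_add, add_comm]
  rw [sub_neg_eq_add] at h
  refine h.trans ?_
  have : (1 - ‖z‖)⁻¹ ≤ 2 := by
    rw [inv_le_comm₀ (by linarith) two_pos]
    linarith
  nlinarith [sq_nonneg ‖z‖]

variable [IsTotallyReal K]

lemma exists_re_tsum_prime_le (h2 : finrank ℚ K = 2) {χ : (Ideal (𝓞 K))⁰ →* ℂ} (hχ : ∀ 𝔞, ‖χ 𝔞‖ ≤ 1)
    (hB : ∃ B : ℝ, ∀ s : ℝ, 1 < s → s ≤ 2 → ‖∑' 𝔞, mulAbsNormRpow χ s 𝔞‖ ≤ B) :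
    ∃ B : ℝ, ∀ s : ℝ, 1 < s → s ≤ 2 →
      (∑' 𝔭, mulAbsNormRpow χ s (primeToNonzero 𝔭)).re ≤ B := by
  obtain ⟨B, hB⟩ := hB
  set Z := ∑' 𝔭, (Ideal.absNorm (primeToNonzero (K := K) 𝔭 : Ideal (𝓞 K)) : ℝ) ^ (-2 : ℝ)
  refine ⟨Real.log B + Z, fun s hs hs2 => ?_⟩
  have hle (𝔞) := norm_mulAbsNormRpow_le hχ s 𝔞
  have hsum : Summable fun 𝔞 => ‖mulAbsNormRpow χ s 𝔞‖ :=
    (summable_absNorm_rpow h2 hs hs2).of_nonneg_of_le (fun _ => norm_nonneg _) hle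
  have hsumP : Summable fun 𝔭 => mulAbsNormRpow χ s (primeToNonzero 𝔭) :=
    (hsum.comp_injective primeToNonzero_injective).of_norm
  have hsumL := hsumP.clog_one_sub.neg
  have hexp := exp_tsum_prime_ideals _ hsum
  have hlog : (∑' 𝔭, -Complex.log (1 - mulAbsNormRpow χ s (primeToNonzero 𝔭))).re ≤
      Real.log B := by
    have h := hB s hs hs2
    rw [← hexp, Complex.norm_exp] at h
    exact (Real.le_log_iff_exp_le ((Real.exp_pos _).trans_le h)).2 h
  have hsumZ : Summable fun 𝔭 =>
      (Ideal.absNorm (primeToNonzero (K := K) 𝔭 : Ideal (𝓞 K)) : ℝ) ^ (-2 : ℝ) :=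
    (summable_absNorm_rpow h2 one_lt_two le_rfl).comp_injective primeToNonzero_injective
  have hdiff : ‖∑' 𝔭, (-Complex.log (1 - mulAbsNormRpow χ s (primeToNonzero 𝔭)) -
      mulAbsNormRpow χ s (primeToNonzero 𝔭))‖ ≤ Z := by
    refine tsum_of_norm_bounded hsumZ.hasSum fun 𝔭 => ?_
    have h2N : (2 : ℝ) ≤ Ideal.absNorm (primeToNonzero 𝔭 : Ideal (𝓞 K)) :=
      mod_cast two_le_absNorm_of_prime 𝔭
    have hN : ‖mulAbsNormRpow χ s (primeToNonzero 𝔭)‖ ≤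
        (Ideal.absNorm (primeToNonzero 𝔭 : Ideal (𝓞 K)) : ℝ)⁻¹ := by
      refine (hle _).trans ?_
      rw [← Real.rpow_neg_one]
      exact Real.rpow_le_rpow_of_exponent_le (by linarith) (by linarith)
    refine (norm_neg_log_one_sub_sub_le (hN.trans ?_)).trans ?_
    · rw [one_div]
      exact inv_anti₀ two_pos h2N
    · rw [Real.rpow_neg (by linarith), Real.rpow_two, ← inv_pow]
      exact pow_le_pow_left₀ (norm_nonneg _) hN 2
  rw [hsumL.tsum_sub hsumP] at hdiff
  have := (Complex.abs_re_le_norm _).trans hdiff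
  rw [Complex.sub_re, abs_le] at this
  linarith

open Classical in
lemma exists_re_tsum_prime_class_le (h2 : finrank ℚ K = 2)
    {ψ : ClassGroup (𝓞 K) →* ℂˣ} (hψ : ∃ c, ψ c ^ 2 ≠ 1)
    {n : ℕ} (hn : n ≠ 0) :
    ∃ B : ℝ, ∀ s : ℝ, 1 < s → s ≤ 2 → (∑' 𝔭 : {𝔭 : Ideal (𝓞 K) // Prime 𝔭},
      if (Ideal.absNorm (𝔭 : Ideal (𝓞 K)) : ZMod n) = 1 then
        ((ψ (ClassGroup.mk0 (primeToNonzero 𝔭)) : ℂ)).re *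
          (Ideal.absNorm (𝔭 : Ideal (𝓞 K)) : ℝ) ^ (-s) else 0) ≤ B := by
  have : NeZero n := ⟨hn⟩
  choose B hB using fun η : DirichletCharacter ℂ n => exists_re_tsum_prime_le h2
    (norm_twist_le ψ η) (exists_norm_tsum_twist_le h2 hψ hn η)
  refine ⟨(n.totient : ℝ)⁻¹ * ∑ η, B η, fun s hs hs2 => ?_⟩
  rw [le_inv_mul_iff₀ (by exact_mod_cast Nat.totient_pos.2 (Nat.pos_of_ne_zero hn))]
  refine le_of_eq_of_le ?_ (Finset.sum_le_sum fun η (_ : η ∈ Finset.univ) => hB η s hs hs2)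
  have hsum (η : DirichletCharacter ℂ n) :
      Summable fun 𝔭 => mulAbsNormRpow (twist ψ η) s (primeToNonzero 𝔭) :=
    (summable_twist h2 ψ η hs hs2).comp_injective primeToNonzero_injective
  rw [← Complex.re_sum, ← Summable.tsum_finsetSum fun η _ => hsum η,
    Complex.re_tsum (summable_sum fun η _ => hsum η), ← tsum_mul_left]
  refine tsum_congr fun 𝔭 => ?_
  simp only [mulAbsNormRpow_apply, twist_apply]
  rw [← Finset.sum_mul, ← Finset.mul_sum, DirichletCharacter.sum_characters_eq]
  by_cases h : (Ideal.absNorm (primeToNonzero 𝔭 : Ideal (𝓞 K)) : ZMod n) = 1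
  · rw [if_pos h, if_pos (by exact h), mul_assoc, ← Complex.ofReal_natCast, ← Complex.ofReal_mul,
      Complex.re_mul_ofReal]
    exact mul_left_comm _ _ _
  · rw [if_neg h, if_neg (by exact h), mul_zero, mul_zero, zero_mul, Complex.zero_re]

end PrimeSums

section Dirichlet
open ArithmeticFunction.vonMangoldt Filter Topology

/-- Dirichlet's theorem in its quantitative form: the sum of the reciprocals of the primes
`p ≡ 1 (mod n)` diverges. -/
lemma not_summable_one_div_primes_one_mod {n : ℕ} (hn : n ≠ 0) :
    ¬ Summable fun p : ℕ => if p.Prime ∧ (p : ZMod n) = 1 then (p : ℝ)⁻¹ else 0 := by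
  have : NeZero n := ⟨hn⟩
  intro H
  obtain ⟨C, hC⟩ := LSeries_residueClass_lower_bound (q := n) (a := 1) isUnit_one
  have hnp := summable_residueClass_non_primes_div (q := n) 1
  set D := ∑' m : ℕ, (if m.Prime then 0 else residueClass (1 : ZMod n) m) / m
  set f : ℝ → ℕ → ℝ := fun δ p =>
    δ * ((if p.Prime then residueClass (1 : ZMod n) p else 0) / (p : ℝ) ^ (1 + δ))
  set g : ℕ → ℝ := fun p => if p.Prime ∧ (p : ZMod n) = 1 then (p : ℝ)⁻¹ else 0
  have hfg (δ : ℝ) (hδ : 0 < δ) (p : ℕ) : ‖f δ p‖ ≤ g p := by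
    by_cases hp : p.Prime
    · by_cases hp1 : (p : ZMod n) = 1
      · have hp0 : (0 : ℝ) < p := by exact_mod_cast hp.pos
        have hmem : p ∈ {m : ℕ | (m : ZMod n) = 1} := hp1
        simp only [f, g, hp, hp1, if_true, and_self, residueClass, Set.indicator_of_mem hmem,
          ArithmeticFunction.vonMangoldt_apply_prime hp]
        have hlog : 0 ≤ Real.log p := Real.log_natCast_nonneg p
        rw [Real.norm_of_nonneg (by positivity), Real.rpow_add hp0, Real.rpow_one,
          ← mul_div_assoc, div_le_iff₀ (by positivity), inv_mul_cancel_left₀ hp0.ne']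
        have h := Real.add_one_le_exp (Real.log p * δ)
        rw [← Real.rpow_def_of_pos hp0] at h
        linarith
      · simp [f, g, hp, hp1, residueClass]
    · simp [f, g, hp]
  have hlim : Tendsto (fun δ => ∑' p, f δ p) (𝓝[>] 0) (𝓝 (∑' _ : ℕ, (0 : ℝ))) := by
    refine tendsto_tsum_of_dominated_convergence H (fun p => ?_)
      (eventually_mem_nhdsWithin.mono fun δ hδ p => hfg δ hδ p)
    refine tendsto_nhdsWithin_of_tendsto_nhds ?_
    rcases eq_or_ne p 0 with rfl | hp
    · simp [f, Nat.not_prime_zero]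
    have hp0 : (p : ℝ) ≠ 0 := Nat.cast_ne_zero.2 hp
    have : ContinuousAt (fun δ => f δ p) 0 := by
      simp only [f]
      fun_prop (disch := positivity)
    simpa [f] using this.tendsto
  have hlow : ∀ᶠ δ in 𝓝[>] (0 : ℝ), (n.totient : ℝ)⁻¹ - (C + D) * δ ≤ ∑' p, f δ p := by
    filter_upwards [Ioo_mem_nhdsGT (zero_lt_one' ℝ)] with δ hδ
    have h := hC (x := 1 + δ) ⟨by linarith [hδ.1], by linarith [hδ.2]⟩
    have hle (m : ℕ) : (if m.Prime then 0 else residueClass (1 : ZMod n) m) / (m : ℝ) ^ (1 + δ) ≤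
        (if m.Prime then 0 else residueClass (1 : ZMod n) m) / m := by
      have h0 : 0 ≤ if m.Prime then 0 else residueClass (1 : ZMod n) m := by
        split_ifs
        exacts [le_rfl, residueClass_nonneg _ _]
      rcases eq_or_ne m 0 with rfl | hm
      · simp
      · have hm1 : (1 : ℝ) ≤ m := by exact_mod_cast Nat.one_le_iff_ne_zero.2 hm
        refine div_le_div_of_nonneg_left h0 (by positivity) ?_
        exact Real.self_le_rpow_of_one_le hm1 (by linarith [hδ.1])
    have h0 (m : ℕ) : 0 ≤
        (if m.Prime then 0 else residueClass (1 : ZMod n) m) / (m : ℝ) ^ (1 + δ) := by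
      split_ifs
      · simp
      · exact div_nonneg (residueClass_nonneg _ _) (by positivity)
    have hs := hnp.of_nonneg_of_le h0 hle
    have hf : Summable (f δ) := H.of_norm_bounded (hfg δ hδ.1)
    have hf' : Summable fun p : ℕ =>
        (if p.Prime then residueClass (1 : ZMod n) p else 0) / (p : ℝ) ^ (1 + δ) :=
      (summable_mul_left_iff hδ.1.ne').1 hf
    have hsplit : ∑' m, residueClass (1 : ZMod n) m / (m : ℝ) ^ (1 + δ) =
        ∑' m : ℕ, (if m.Prime then residueClass (1 : ZMod n) m else 0) / (m : ℝ) ^ (1 + δ) +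
        ∑' m : ℕ, (if m.Prime then 0 else residueClass (1 : ZMod n) m) / (m : ℝ) ^ (1 + δ) := by
      rw [← hf'.tsum_add hs]
      refine tsum_congr fun m => ?_
      split_ifs <;> simp
    rw [hsplit, add_sub_cancel_left] at h
    have hD := hs.tsum_le_tsum hle hnp
    have : (n.totient : ℝ)⁻¹ / δ - (C + D) ≤
      ∑' m : ℕ, (if m.Prime then residueClass (1 : ZMod n) m else 0) / (m : ℝ) ^ (1 + δ) := by
      linarith
    have := mul_le_mul_of_nonneg_left this hδ.1.le
    rw [mul_sub, mul_div_cancel₀ _ hδ.1.ne', ← tsum_mul_left, mul_comm δ] at this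
    exact this
  have hlim2 : Tendsto (fun δ : ℝ => (n.totient : ℝ)⁻¹ - (C + D) * δ) (𝓝[>] 0)
      (𝓝 (n.totient : ℝ)⁻¹) := by
    refine tendsto_nhdsWithin_of_tendsto_nhds ?_
    have : ContinuousAt (fun δ : ℝ => (n.totient : ℝ)⁻¹ - (C + D) * δ) 0 := by fun_prop
    simpa using this.tendsto
  have h := le_of_tendsto_of_tendsto hlim2 hlim hlow
  rw [tsum_zero] at h
  have : (0 : ℝ) < (n.totient : ℝ)⁻¹ :=
    inv_pos.2 (Nat.cast_pos.2 (Nat.totient_pos.2 (Nat.pos_of_ne_zero hn)))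
  linarith

end Dirichlet

section ClassCharacter
variable {K : Type*} [Field K] [NumberField K]

lemma exists_prime_mem {R : Type*} [CommRing R] {𝔭 : Ideal R} [h𝔭 : 𝔭.IsPrime] {m : ℕ}
    (hm : m ≠ 0) (hmem : (m : R) ∈ 𝔭) : ∃ p : ℕ, p.Prime ∧ (p : R) ∈ 𝔭 := by
  induction m using induction_on_primes with
  | zero => exact absurd rfl hm
  | one => exact absurd ((Ideal.eq_top_iff_one _).2 (by simpa using hmem)) h𝔭.ne_top
  | prime_mul p a hp ih =>
    rw [Nat.cast_mul] at hmem
    rcases h𝔭.mem_or_mem hmem with h | h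
    · exact ⟨p, hp, h⟩
    · exact ih (right_ne_zero_of_mul hm) h

lemma absNorm_prime_or_exists_eq_span (h2 : finrank ℚ K = 2) {𝔭 : Ideal (𝓞 K)} (h𝔭 : Prime 𝔭) :
    (Ideal.absNorm 𝔭).Prime ∨ ∃ p : ℕ, 𝔭 = Ideal.span {(p : 𝓞 K)} := by
  have hprime := Ideal.isPrime_of_prime h𝔭
  obtain ⟨p, hp, hmem⟩ := exists_prime_mem (Ideal.absNorm_eq_zero_iff.not.2 h𝔭.ne_zero)
    (Ideal.absNorm_mem 𝔭)
  obtain ⟨𝔮, h𝔮⟩ := Ideal.dvd_iff_le.2 ((Ideal.span_singleton_le_iff_mem _).2 hmem)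
  have hN := congrArg Ideal.absNorm h𝔮
  rw [map_mul, Ideal.absNorm_span_natCast, RingOfIntegers.rank, h2] at hN
  obtain ⟨k, hk, hk'⟩ := (Nat.dvd_prime_pow hp).1 (Dvd.intro _ hN.symm)
  interval_cases k
  · exact absurd (Ideal.absNorm_eq_one_iff.1 (by simpa using hk')) hprime.ne_top
  · left
    rwa [hk', pow_one]
  · right
    rw [hk', eq_comm, mul_eq_left₀ (pow_ne_zero _ hp.ne_zero), Ideal.absNorm_eq_one_iff] at hN
    exact ⟨p, by rw [h𝔮, hN, Ideal.mul_top]⟩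

open Classical in
lemma summable_absNorm_inv_of_not_prime (h2 : finrank ℚ K = 2) :
    Summable fun 𝔭 : {𝔭 : Ideal (𝓞 K) // Prime 𝔭} =>
      if (Ideal.absNorm (𝔭 : Ideal (𝓞 K))).Prime then 0
      else ((Ideal.absNorm (𝔭 : Ideal (𝓞 K)) : ℝ))⁻¹ := by
  set S : Set {𝔭 : Ideal (𝓞 K) // Prime 𝔭} :=
    {𝔭 | ¬ (Ideal.absNorm (𝔭 : Ideal (𝓞 K))).Prime} with hS
  have hex (𝔭 : S) : ∃ p : ℕ, ((𝔭 : {𝔭 : Ideal (𝓞 K) // Prime 𝔭}) : Ideal (𝓞 K)) =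
      Ideal.span {(p : 𝓞 K)} := (absNorm_prime_or_exists_eq_span h2 𝔭.1.2).resolve_left 𝔭.2
  choose f hf using hex
  have hinj : Function.Injective f := fun 𝔭 𝔮 h =>
    Subtype.ext (Subtype.ext (by rw [hf, hf, h]))
  have hsum : Summable fun m : ℕ => ((m : ℝ) ^ 2)⁻¹ := Real.summable_nat_pow_inv.2 one_lt_two
  refine (summable_subtype_iff_indicator (s := S)
    (f := fun 𝔭 : {𝔭 : Ideal (𝓞 K) // Prime 𝔭} =>
      ((Ideal.absNorm (𝔭 : Ideal (𝓞 K)) : ℝ))⁻¹)).1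
    ((hsum.comp_injective hinj).congr fun 𝔭 => ?_) |>.congr fun 𝔭 => ?_
  · rw [Function.comp_apply, Function.comp_apply, hf, Ideal.absNorm_span_natCast,
      RingOfIntegers.rank, h2, Nat.cast_pow]
  · by_cases h : (Ideal.absNorm (𝔭 : Ideal (𝓞 K))).Prime
    · rw [Set.indicator_of_notMem (s := S) (by simpa [hS] using h), if_pos h]
    · rw [Set.indicator_of_mem h, if_neg h]

variable [IsTotallyReal K]

lemma summable_prime_absNorm_rpow (h2 : finrank ℚ K = 2) {s : ℝ} (hs : 1 < s) (hs2 : s ≤ 2) :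
    Summable fun 𝔭 : {𝔭 : Ideal (𝓞 K) // Prime 𝔭} =>
      (Ideal.absNorm (𝔭 : Ideal (𝓞 K)) : ℝ) ^ (-s) := by
  have h := (summable_absNorm_rpow h2 hs hs2).comp_injective primeToNonzero_injective
  exact h

/-- In a real quadratic field, a class group character which is not quadratic is nontrivial
on some prime ideal of degree one and norm congruent to `1` modulo `n`. -/
theorem exists_class_char_ne_one (h2 : finrank ℚ K = 2) {n : ℕ} (hn : n ≠ 0)
    (hP : ∀ p : ℕ, p.Prime → (p : ZMod n) = 1 → ∃ P : Ideal (𝓞 K), Ideal.absNorm P = p)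
    {ψ : ClassGroup (𝓞 K) →* ℂˣ} (hψ : ∃ c, ψ c ^ 2 ≠ 1) :
    ∃ 𝔞 : (Ideal (𝓞 K))⁰, (Ideal.absNorm (𝔞 : Ideal (𝓞 K))).Prime ∧
      (Ideal.absNorm (𝔞 : Ideal (𝓞 K)) : ZMod n) = 1 ∧ ψ (ClassGroup.mk0 𝔞) ≠ 1 := by
  classical
  by_contra! hcon
  obtain ⟨B, hB⟩ := exists_re_tsum_prime_class_le h2 hψ hn
  have hV := summable_absNorm_inv_of_not_prime h2
  set V : {𝔭 : Ideal (𝓞 K) // Prime 𝔭} → ℝ := fun 𝔭 =>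
    if (Ideal.absNorm (𝔭 : Ideal (𝓞 K))).Prime then 0
      else ((Ideal.absNorm (𝔭 : Ideal (𝓞 K)) : ℝ))⁻¹ with hVdef
  set T : ℝ → {𝔭 : Ideal (𝓞 K) // Prime 𝔭} → ℝ := fun s 𝔭 =>
    if (Ideal.absNorm (𝔭 : Ideal (𝓞 K)) : ZMod n) = 1 then
        ((ψ (ClassGroup.mk0 (primeToNonzero 𝔭)) : ℂ)).re *
          (Ideal.absNorm (𝔭 : Ideal (𝓞 K)) : ℝ) ^ (-s) else 0
  have hex (p : {p : ℕ | p.Prime ∧ (p : ZMod n) = 1}) :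
      ∃ 𝔭 : {𝔭 : Ideal (𝓞 K) // Prime 𝔭}, Ideal.absNorm (𝔭 : Ideal (𝓞 K)) = p := by
    obtain ⟨P, hPp⟩ := hP p p.2.1 p.2.2
    have hprime : P.IsPrime := Ideal.isPrime_of_irreducible_absNorm (by
      rw [hPp]
      exact p.2.1)
    refine ⟨⟨P, Ideal.prime_of_isPrime ?_ hprime⟩, hPp⟩
    rintro rfl
    exact p.2.1.ne_zero (hPp.symm.trans Ideal.absNorm_bot)
  choose P hPn using hex
  have hinj : Function.Injective P := fun p q h => Subtype.ext (by rw [← hPn p, ← hPn q, h])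
  have hbound (s : ℝ) (hs : 1 < s) (hs2 : s ≤ 2)
      (A : Finset {p : ℕ | p.Prime ∧ (p : ZMod n) = 1}) :
      ∑ p ∈ A, ((p : ℕ) : ℝ) ^ (-s) ≤ B + ∑' 𝔭, V 𝔭 := by
    have hNs : Summable fun 𝔭 : {𝔭 : Ideal (𝓞 K) // Prime 𝔭} =>
        (Ideal.absNorm (𝔭 : Ideal (𝓞 K)) : ℝ) ^ (-s) :=
      summable_prime_absNorm_rpow h2 hs hs2
    have hT : Summable (T s) := by
      refine hNs.of_norm_bounded fun 𝔭 => ?_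
      simp only [T]
      split_ifs
      · rw [norm_mul, Real.norm_of_nonneg (Real.rpow_nonneg (Nat.cast_nonneg _) _)]
        refine mul_le_of_le_one_left (Real.rpow_nonneg (Nat.cast_nonneg _) _) ?_
        exact (Complex.abs_re_le_norm _).trans (norm_classGroup_char ψ _).le
      · rw [norm_zero]
        exact Real.rpow_nonneg (Nat.cast_nonneg _) _
    have hpos (𝔭 : {𝔭 : Ideal (𝓞 K) // Prime 𝔭}) : 0 ≤ T s 𝔭 + V 𝔭 := by
      by_cases h : (Ideal.absNorm (𝔭 : Ideal (𝓞 K))).Prime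
      · simp only [T, V, if_pos h, add_zero]
        split_ifs with h1
        · rw [hcon (primeToNonzero 𝔭) h h1, Units.val_one, Complex.one_re, one_mul]
          positivity
        · exact le_rfl
      · simp only [T, V, if_neg h]
        have hN : (1 : ℝ) ≤ Ideal.absNorm (𝔭 : Ideal (𝓞 K)) := by
          exact_mod_cast one_le_two.trans (two_le_absNorm_of_prime 𝔭)
        split_ifs
        · have h1 := Real.rpow_le_rpow_of_exponent_le hN (neg_le_neg hs.le)
          rw [Real.rpow_neg_one] at h1
          have h3 := (abs_le.1 ((Complex.abs_re_le_norm
            (ψ (ClassGroup.mk0 (primeToNonzero 𝔭)) : ℂ)).trans (norm_classGroup_char ψ _).le)).1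
          have h4 := Real.rpow_nonneg (zero_le_one.trans hN) (-s)
          nlinarith
        · positivity
    calc ∑ p ∈ A, ((p : ℕ) : ℝ) ^ (-s) = ∑ p ∈ A, (T s (P p) + V (P p)) := by
          refine Finset.sum_congr rfl fun p _ => ?_
          have h1 := hcon (primeToNonzero (P p)) (by
            change (Ideal.absNorm (P p : Ideal (𝓞 K))).Prime
            rw [hPn]; exact p.2.1) (by
            change ((Ideal.absNorm (P p : Ideal (𝓞 K)) : ℕ) : ZMod n) = 1
            rw [hPn]; exact p.2.2)
          simp only [T, V, hPn, if_pos p.2.1, if_pos p.2.2, h1, Units.val_one, Complex.one_re,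
            one_mul, add_zero]
      _ = ∑ 𝔭 ∈ A.map ⟨P, hinj⟩, (T s 𝔭 + V 𝔭) := by simp
      _ ≤ ∑' 𝔭, (T s 𝔭 + V 𝔭) := (hT.add hV).sum_le_tsum _ fun 𝔭 _ => hpos 𝔭
      _ ≤ B + ∑' 𝔭, V 𝔭 := by
          rw [hT.tsum_add hV]
          exact add_le_add_left (hB s hs hs2) _
  refine not_summable_one_div_primes_one_mod hn ?_
  have hsub : Summable fun p : {p : ℕ | p.Prime ∧ (p : ZMod n) = 1} => ((p : ℕ) : ℝ)⁻¹ := by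
    refine summable_of_sum_le (c := B + ∑' 𝔭, V 𝔭) (fun p => by positivity) fun A => ?_
    have hcont : ContinuousAt (fun s : ℝ => ∑ p ∈ A, ((p : ℕ) : ℝ) ^ (-s)) 1 := by
      refine tendsto_finsetSum _ fun p _ => ?_
      have hp : ((p : ℕ) : ℝ) ≠ 0 := Nat.cast_ne_zero.2 p.2.1.ne_zero
      exact (Real.continuousAt_const_rpow hp).comp continuousAt_neg
    have h := le_of_tendsto (hcont.tendsto.mono_left nhdsWithin_le_nhds) (by
      filter_upwards [Ioo_mem_nhdsGT one_lt_two] with s hs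
      exact hbound s hs.1 hs.2.le A)
    simpa only [Real.rpow_neg_one] using h
  refine ((summable_subtype_iff_indicator (f := fun p : ℕ => (p : ℝ)⁻¹)).1 hsub).congr fun p => ?_
  simp [Set.indicator_apply]

end ClassCharacter

section ClassNorm
variable (R : Type*) {S : Type*} [CommRing R] [CommRing S] [IsDedekindDomain R]
  [IsDedekindDomain S] [Algebra R S] [Module.Finite R S] [IsTorsionFree R S]

/-- The relative norm as a homomorphism between the monoids of nonzero ideals. -/
noncomputable def relNormNonzero : (Ideal S)⁰ →* (Ideal R)⁰ where
  toFun I := ⟨Ideal.relNorm R (I : Ideal S), mem_nonZeroDivisors_of_ne_zero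
    (Ideal.relNorm_eq_bot_iff.not.2 (nonZeroDivisors.ne_zero I.2))⟩
  map_one' := Subtype.ext (by simp)
  map_mul' I J := Subtype.ext (by simp)

lemma coe_relNormNonzero (I : (Ideal S)⁰) :
    (relNormNonzero R I : Ideal R) = Ideal.relNorm R (I : Ideal S) := rfl

variable {R} in
lemma mk0_relNormNonzero_congr {I J : (Ideal S)⁰} (h : ClassGroup.mk0 I = ClassGroup.mk0 J) :
    ClassGroup.mk0 (relNormNonzero R I) = ClassGroup.mk0 (relNormNonzero R J) := by
  obtain ⟨x, y, hx, hy, hxy⟩ := ClassGroup.mk0_eq_mk0_iff.1 h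
  refine ClassGroup.mk0_eq_mk0_iff.2 ⟨Algebra.intNorm R S x, Algebra.intNorm R S y,
    Algebra.intNorm_ne_zero.2 hx, Algebra.intNorm_ne_zero.2 hy, ?_⟩
  have := congrArg (Ideal.relNorm R) hxy
  simpa only [map_mul, Ideal.relNorm_singleton, coe_relNormNonzero] using this

/-- The homomorphism of class groups induced by the relative norm of ideals. -/
noncomputable def classNorm : ClassGroup S →* ClassGroup R :=
  MonoidHom.mk' (fun c => ClassGroup.mk0 (relNormNonzero R
    (Function.surjInv ClassGroup.mk0_surjective c))) fun a b => by
    rw [← map_mul, ← map_mul]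
    refine mk0_relNormNonzero_congr ?_
    rw [map_mul]
    simp only [Function.surjInv_eq]

lemma classNorm_mk0 (I : (Ideal S)⁰) :
    classNorm R (ClassGroup.mk0 I) = ClassGroup.mk0 (relNormNonzero R I) :=
  mk0_relNormNonzero_congr (Function.surjInv_eq _ _)

end ClassNorm

section DegreeOne
variable {K H : Type*} [Field K] [NumberField K] [Field H] [NumberField H] [Algebra K H]

lemma relNorm_eq_under_of_absNorm_prime {𝔓 : Ideal (𝓞 H)}
    (h : (Ideal.absNorm 𝔓).Prime) : Ideal.relNorm (𝓞 K) 𝔓 = 𝔓.under (𝓞 K) := by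
  have hP : 𝔓.IsPrime := Ideal.isPrime_of_irreducible_absNorm h
  have hP0 : 𝔓 ≠ ⊥ := by
    rintro rfl
    exact h.ne_zero Ideal.absNorm_bot
  have hmax : 𝔓.IsMaximal := hP.isMaximal hP0
  have : (𝔓.under (𝓞 K)).IsMaximal := Ideal.IsMaximal.under (𝓞 K) 𝔓
  have hpow := Ideal.relNorm_eq_pow_of_isMaximal 𝔓 (𝔓.under (𝓞 K))
  have habs := Ideal.absNorm_relNorm (𝓞 K) (𝓞 H) 𝔓
  rw [hpow, map_pow] at habs
  rw [hpow, ((Nat.Prime.pow_eq_iff h).1 habs).2, pow_one]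

lemma absNorm_under_of_absNorm_prime {𝔓 : Ideal (𝓞 H)} (h : (Ideal.absNorm 𝔓).Prime) :
    Ideal.absNorm (𝔓.under (𝓞 K)) = Ideal.absNorm 𝔓 := by
  rw [← relNorm_eq_under_of_absNorm_prime h, Ideal.absNorm_relNorm]

end DegreeOne

section Quadratic
open scoped Pointwise
variable {K : Type*} [Field K] [NumberField K]

/-- In a quadratic field, the product of a prime ideal of degree one with its conjugate is
principal. -/
lemma mul_smul_eq_span_absNorm [IsGalois ℚ K] (h2 : finrank ℚ K = 2) {τ : Gal(K/ℚ)} (hτ : τ ≠ 1)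
    {𝔭 : Ideal (𝓞 K)} (h : (Ideal.absNorm 𝔭).Prime) :
    𝔭 * τ • 𝔭 = Ideal.span {(Ideal.absNorm 𝔭 : 𝓞 K)} := by
  set p := Ideal.absNorm 𝔭 with hp
  have hmem (𝔮 : Ideal (𝓞 K)) (h𝔮 : Ideal.absNorm 𝔮 = p) :
      𝔮.IsPrime ∧ 𝔮.LiesOver (Ideal.span {(p : ℤ)}) := by
    have hprime : 𝔮.IsPrime := Ideal.isPrime_of_irreducible_absNorm (h𝔮 ▸ h)
    refine ⟨hprime, ⟨?_⟩⟩
    have := Fact.mk h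
    have : (Ideal.span {(p : ℤ)}).IsMaximal := Int.ideal_span_isMaximal_of_prime p
    refine this.eq_of_le (Ideal.IsPrime.under ℤ 𝔮).ne_top ?_
    rw [Ideal.span_singleton_le_iff_mem, Ideal.mem_comap, ← h𝔮]
    simpa using Ideal.absNorm_mem 𝔮
  obtain ⟨𝔮, h𝔮⟩ : 𝔭 ∣ Ideal.span {(p : 𝓞 K)} :=
    Ideal.dvd_iff_le.2 ((Ideal.span_singleton_le_iff_mem _).2 (Ideal.absNorm_mem 𝔭))
  have hN𝔮 : Ideal.absNorm 𝔮 = p := by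
    have hN := congrArg Ideal.absNorm h𝔮
    rw [map_mul, Ideal.absNorm_span_natCast, RingOfIntegers.rank, h2, ← hp, sq] at hN
    exact (Nat.eq_of_mul_eq_mul_left h.pos hN).symm
  obtain ⟨_, _⟩ := hmem 𝔭 rfl
  obtain ⟨_, _⟩ := hmem 𝔮 hN𝔮
  have hτp : τ • Ideal.span {(p : 𝓞 K)} = Ideal.span {(p : 𝓞 K)} := by
    rw [Ideal.pointwise_smul_def, Ideal.map_span, Set.image_singleton]
    simp
  obtain ⟨σ, hσ⟩ := Ideal.exists_smul_eq_of_isGaloisGroup (Ideal.span {(p : ℤ)}) 𝔭 𝔮 Gal(K/ℚ)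
  suffices τ • 𝔭 = 𝔮 by rw [this, h𝔮]
  rcases eq_or_ne σ 1 with rfl | hσ1
  · rw [one_smul] at hσ
    rw [← hσ] at h𝔮 ⊢
    rw [h𝔮, ← sq, smul_pow'] at hτp
    exact pow_left_injective two_ne_zero hτp
  · have hcard : Nat.card Gal(K/ℚ) = 2 := by rw [IsGalois.card_aut_eq_finrank, h2]
    rw [← hσ, (Nat.card_eq_two_iff' (1 : Gal(K/ℚ))).1 hcard |>.unique hτ hσ1]

end Quadratic

section Composite
open scoped Pointwise
variable {K K' H : Type*} [Field K] [NumberField K] [Field K'] [NumberField K']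
  [Field H] [NumberField H] [Algebra K H] [Algebra K' H]

lemma relNorm_smul_ringOfIntegers (σ : Gal(H/K')) (𝔓 : Ideal (𝓞 H)) :
    Ideal.relNorm (𝓞 K') (σ • 𝔓) = Ideal.relNorm (𝓞 K') 𝔓 := by
  have : SMulCommClass Gal(H/K') (𝓞 K') (𝓞 H) := by
    refine ⟨fun σ a x => ?_⟩
    have hσ : σ • algebraMap (𝓞 K') (𝓞 H) a = algebraMap (𝓞 K') (𝓞 H) a :=
      RingOfIntegers.ext (σ.commutes (a : K'))
    rw [Algebra.smul_def, Algebra.smul_def, smul_mul', hσ]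
  exact Ideal.relNorm_smul _ _ _

lemma under_smul_eq [Normal ℚ K] (σ : Gal(H/K')) (𝔓 : Ideal (𝓞 H)) :
    (σ • 𝔓).under (𝓞 K) =
      ((σ.restrictScalars ℚ).restrictNormal K : Gal(K/ℚ)) • 𝔓.under (𝓞 K) := by
  set τ : Gal(K/ℚ) := (σ.restrictScalars ℚ).restrictNormal K with hτ
  have hcomm (y : K) : algebraMap K H (τ y) = σ (algebraMap K H y) :=
    (σ.restrictScalars ℚ).restrictNormal_commutes K y
  ext x
  rw [Ideal.mem_pointwise_smul_iff_inv_smul_mem, Ideal.mem_comap, Ideal.mem_comap,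
    Ideal.mem_pointwise_smul_iff_inv_smul_mem]
  suffices σ⁻¹ • algebraMap (𝓞 K) (𝓞 H) x = algebraMap (𝓞 K) (𝓞 H) (τ⁻¹ • x) by rw [this]
  rw [inv_smul_eq_iff]
  refine RingOfIntegers.ext ?_
  have h := hcomm ((τ⁻¹ • x : 𝓞 K) : K)
  have h2 : τ ((τ⁻¹ • x : 𝓞 K) : K) = x := by
    change (((τ • τ⁻¹ • x : 𝓞 K)) : K) = x
    rw [smul_inv_smul]
  rw [h2] at h
  exact h

/-- A character of `C(K) × C(K')` which vanishes on the norms from `C(H)` is of order dividing `4`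
on the real quadratic factor `C(K)`, as soon as some automorphism of `H` is trivial on `K'` and
not on `K`. -/
theorem pow_four_eq_one_of_classNorm [IsTotallyReal K] [IsGalois ℚ K] (h2 : finrank ℚ K = 2)
    {σ : Gal(H/K')} (hσ : ∃ x : K, σ (algebraMap K H x) ≠ algebraMap K H x)
    {n : ℕ} (hn : n ≠ 0)
    (hH : ∀ 𝔓 : Ideal (𝓞 H), 𝔓.IsPrime → ∀ p : ℕ, p.Prime → (p : ZMod n) = 1 →
      (p : 𝓞 H) ∈ 𝔓 → Ideal.absNorm 𝔓 = p)
    {ψ : ClassGroup (𝓞 K) →* ℂˣ} {ψ' : ClassGroup (𝓞 K') →* ℂˣ}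
    (hψ : ∀ c : ClassGroup (𝓞 H), ψ (classNorm (𝓞 K) c) * ψ' (classNorm (𝓞 K') c) = 1)
    (c : ClassGroup (𝓞 K)) : ψ c ^ 4 = 1 := by
  by_contra hc
  have hP (p : ℕ) (hp : p.Prime) (hp1 : (p : ZMod n) = 1) :
      ∃ P : Ideal (𝓞 K), Ideal.absNorm P = p := by
    obtain ⟨𝔓, h𝔓, hle⟩ := Ideal.exists_le_maximal (Ideal.span {(p : 𝓞 H)}) (by
      rw [Ne, ← Ideal.absNorm_eq_one_iff, Ideal.absNorm_span_natCast, Nat.pow_eq_one,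
        or_iff_left Module.finrank_pos.ne']
      exact hp.ne_one)
    have hN := hH 𝔓 h𝔓.isPrime p hp hp1 ((Ideal.span_singleton_le_iff_mem _).1 hle)
    exact ⟨𝔓.under (𝓞 K), by rw [absNorm_under_of_absNorm_prime (hN ▸ hp), hN]⟩
  obtain ⟨𝔞, hp, hp1, h𝔞⟩ := exists_class_char_ne_one h2 hn hP (ψ := ψ ^ 2)
    ⟨c, by rwa [MonoidHom.pow_apply, ← pow_mul]⟩
  set p := Ideal.absNorm (𝔞 : Ideal (𝓞 K)) with hpdef
  have hprime : (𝔞 : Ideal (𝓞 K)).IsPrime := Ideal.isPrime_of_irreducible_absNorm hp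
  have hmax : (𝔞 : Ideal (𝓞 K)).IsMaximal := hprime.isMaximal (nonZeroDivisors.ne_zero 𝔞.2)
  obtain ⟨𝔓, h𝔓max, h𝔓⟩ := Ideal.exists_maximal_ideal_liesOver_of_isIntegral (S := 𝓞 H)
    (𝔞 : Ideal (𝓞 K))
  have hmem : (p : 𝓞 H) ∈ 𝔓 := by
    have h := Ideal.absNorm_mem (𝔞 : Ideal (𝓞 K))
    rw [h𝔓.over, Ideal.mem_comap, map_natCast, ← h𝔓.over] at h
    exact h
  have hmem' : (p : 𝓞 H) ∈ σ • 𝔓 := by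
    have h := Ideal.smul_mem_pointwise_smul σ _ 𝔓 hmem
    have hfix : σ • (p : 𝓞 H) = p := map_natCast (MulSemiringAction.toRingHom Gal(H/K') (𝓞 H) σ) p
    rwa [hfix] at h
  have h𝔓prime : 𝔓.IsPrime := h𝔓max.isPrime
  have h𝔓' : (σ • 𝔓).IsPrime := inferInstance
  have hN := hH 𝔓 h𝔓max.isPrime p hp hp1 hmem
  have hN' := hH (σ • 𝔓) h𝔓' p hp hp1 hmem'
  have hne : 𝔓 ≠ 0 := fun h => by
    rw [h] at hN
    exact hp.ne_zero (hN.symm.trans Ideal.absNorm_bot)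
  have hne' : σ • 𝔓 ≠ 0 := fun h => by
    rw [h] at hN'
    exact hp.ne_zero (hN'.symm.trans Ideal.absNorm_bot)
  set τ : Gal(K/ℚ) := (σ.restrictScalars ℚ).restrictNormal K with hτ
  have hτ1 : τ ≠ 1 := by
    obtain ⟨x, hx⟩ := hσ
    intro h
    refine hx (((σ.restrictScalars ℚ).restrictNormal_commutes K x).symm.trans ?_)
    rw [← hτ, h, AlgEquiv.one_apply]
  have h1 := hψ (ClassGroup.mk0 ⟨𝔓, mem_nonZeroDivisors_of_ne_zero hne⟩)
  have h2' := hψ (ClassGroup.mk0 ⟨σ • 𝔓, mem_nonZeroDivisors_of_ne_zero hne'⟩)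
  simp only [classNorm_mk0] at h1 h2'
  have e1 : relNormNonzero (𝓞 K') ⟨σ • 𝔓, mem_nonZeroDivisors_of_ne_zero hne'⟩ =
      relNormNonzero (𝓞 K') ⟨𝔓, mem_nonZeroDivisors_of_ne_zero hne⟩ :=
    Subtype.ext (relNorm_smul_ringOfIntegers σ 𝔓)
  have e2 : relNormNonzero (𝓞 K) ⟨𝔓, mem_nonZeroDivisors_of_ne_zero hne⟩ = 𝔞 :=
    Subtype.ext ((relNorm_eq_under_of_absNorm_prime (hN.symm ▸ hp)).trans h𝔓.over.symm)
  set 𝔞' := relNormNonzero (𝓞 K) ⟨σ • 𝔓, mem_nonZeroDivisors_of_ne_zero hne'⟩ with h𝔞'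
  have e3 : (𝔞' : Ideal (𝓞 K)) = τ • (𝔞 : Ideal (𝓞 K)) := by
    rw [h𝔞', coe_relNormNonzero, relNorm_eq_under_of_absNorm_prime (hN'.symm ▸ hp), under_smul_eq,
      ← h𝔓.over]
  rw [e1, ← h1, e2] at h2'
  have h3 := mul_right_cancel h2'
  refine h𝔞 ?_
  rw [MonoidHom.pow_apply, sq]
  nth_rw 2 [← h3]
  rw [← map_mul, ← map_mul]
  convert map_one ψ using 2
  rw [ClassGroup.mk0_eq_one_iff, Submonoid.coe_mul, e3, mul_smul_eq_span_absNorm h2 hτ1 hp]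
  exact ⟨⟨_, rfl⟩⟩

end Composite

section Groups

lemma mem_pPart {G : Type*} [CommGroup G] {p : ℕ} {hp : p.Prime} {g : G} :
    g ∈ pPart G p hp ↔ ∃ k : ℕ, g ^ p ^ k = 1 :=
  Iff.rfl

lemma dvd_pCard_of_dvd_card {G : Type*} [CommGroup G] [Finite G] {p : ℕ} (hp : p.Prime)
    (h : p ∣ Nat.card G) : p ∣ pCard G p hp := by
  have : Fact p.Prime := ⟨hp⟩
  obtain ⟨g, hg⟩ := exists_prime_orderOf_dvd_card' p h
  have hmem : g ∈ pPart G p hp := mem_pPart.2 ⟨1, by rw [pow_one, ← hg, pow_orderOf_eq_one]⟩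
  have hord := orderOf_dvd_natCard (⟨g, hmem⟩ : pPart G p hp)
  rwa [Subgroup.orderOf_mk, hg] at hord

lemma pRank_eq_one_of_pCard_eq {G : Type*} [CommGroup G] {p : ℕ} {hp : p.Prime}
    (h : pCard G p hp = p) : pRank G p hp = 1 := by
  have hbot : (powMonoidHom p : ↥(pPart G p hp) →* ↥(pPart G p hp)).range = ⊥ := by
    rw [eq_bot_iff]
    rintro _ ⟨x, rfl⟩
    have hx : x ^ pCard G p hp = 1 := pow_card_eq_one'
    rwa [h] at hx
  rw [pRank, hbot, Nat.card_congr (QuotientGroup.quotientBot (G := ↥(pPart G p hp))).toEquiv]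
  rw [show Nat.card ↥(pPart G p hp) = p from h, hp.factorization_self]

lemma pCard_mul_pCard_le {G A B : Type*} [CommGroup G] [CommGroup A] [CommGroup B] [Finite G]
    [Finite A] [Finite B] {p k : ℕ} (hp : p.Prime) (hk : ¬ p ∣ k) (f : G →* A × B)
    (hf : ∀ x, x ^ k ∈ f.range) : pCard A p hp * pCard B p hp ≤ pCard G p hp := by
  have hle : (pPart A p hp).prod (pPart B p hp) ≤ (pPart G p hp).map f := by
    rintro y ⟨⟨r, hr⟩, ⟨s, hs⟩⟩
    have hy : y ^ p ^ (r + s) = 1 := by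
      refine Prod.ext ?_ ?_
      · rw [Prod.pow_fst, pow_add, pow_mul, hr, one_pow, Prod.fst_one]
      · rw [Prod.pow_snd, pow_add, mul_comm, pow_mul, hs, one_pow, Prod.snd_one]
    obtain ⟨e, d, hd, hcard⟩ := Nat.exists_eq_pow_mul_and_not_dvd
      (Nat.card_pos (α := G)).ne' p hp.ne_one
    have hcop : (k * d).Coprime (orderOf y) :=
      .coprime_dvd_right (orderOf_dvd_of_pow_eq_one hy) <| .pow_right _ <|
        .symm <| .mul_right (hp.coprime_iff_not_dvd.2 hk) (hp.coprime_iff_not_dvd.2 hd)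
    obtain ⟨w, hw⟩ := exists_pow_eq_self_of_coprime hcop
    obtain ⟨x, hx⟩ := hf y
    refine ⟨x ^ (d * w), mem_pPart.2 ⟨e, ?_⟩, ?_⟩
    · rw [← pow_mul, show d * w * p ^ e = Nat.card G * w by rw [hcard]; ring, pow_mul,
        pow_card_eq_one', one_pow]
    · rw [map_pow, hx, ← pow_mul, ← mul_assoc, pow_mul, hw]
  calc pCard A p hp * pCard B p hp = Nat.card ((pPart A p hp).prod (pPart B p hp)) := by
        rw [Nat.card_congr ((pPart A p hp).prodEquiv (pPart B p hp)).toEquiv, Nat.card_prod]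
        rfl
    _ ≤ Nat.card ((pPart G p hp).map f) := Subgroup.card_le_of_le hle
    _ ≤ pCard G p hp := Nat.card_image_le (Set.toFinite _)

lemma pow_mem_range_prod_of_character {G A B : Type*} [CommGroup G] [CommGroup A] [CommGroup B]
    [Finite A] [Finite B] {k : ℕ} (f : G →* A) (g : G →* B)
    (h : ∀ (ψ : A →* ℂˣ) (ψ' : B →* ℂˣ), (∀ c, ψ (f c) * ψ' (g c) = 1) →
      ψ ^ k = 1 ∧ ψ' ^ k = 1) (x : A × B) : x ^ k ∈ (f.prod g).range := by
  by_contra hx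
  rw [← QuotientGroup.eq_one_iff] at hx
  obtain ⟨χ, hχ⟩ := CommGroup.exists_apply_ne_one_of_hasEnoughRootsOfUnity
    ((A × B) ⧸ (f.prod g).range) ℂ hx
  set θ := χ.comp (QuotientGroup.mk' (f.prod g).range) with hθ
  have hθx (a : A) (b : B) : θ (a, b) =
      (θ.comp (MonoidHom.inl A B)) a * (θ.comp (MonoidHom.inr A B)) b := by
    rw [MonoidHom.comp_apply θ, MonoidHom.comp_apply θ, ← map_mul, MonoidHom.inl_apply,
      MonoidHom.inr_apply, Prod.mk_mul_mk, mul_one, one_mul]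
  obtain ⟨h1, h2⟩ := h (θ.comp (MonoidHom.inl A B)) (θ.comp (MonoidHom.inr A B)) fun c => by
    rw [← hθx, hθ, MonoidHom.comp_apply]
    convert map_one χ
    exact (QuotientGroup.eq_one_iff _).2 ⟨c, rfl⟩
  refine hχ ?_
  change θ (x ^ k) = 1
  rw [map_pow, ← Prod.mk.eta (p := x), hθx, mul_pow, ← MonoidHom.pow_apply, h1,
    ← MonoidHom.pow_apply, h2, MonoidHom.one_apply, MonoidHom.one_apply, mul_one]

end Groups

section Cyclotomic
variable {n : ℕ}

lemma isPrimitiveRoot_zetaC (hn : n ≠ 0) : IsPrimitiveRoot (zetaC n) n :=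
  Complex.isPrimitiveRoot_exp n hn

lemma realCyclo_le_adjoin_zetaC (n : ℕ) : realCyclo n ≤ ℚ⟮zetaC n⟯ := by
  rw [realCyclo, adjoin_simple_le_iff]
  exact add_mem (mem_adjoin_simple_self _ _) (inv_mem (mem_adjoin_simple_self _ _))

lemma isCyclotomicExtension_adjoin_zetaC (hn : n ≠ 0) : IsCyclotomicExtension {n} ℚ ℚ⟮zetaC n⟯ := by
  have : NeZero n := ⟨hn⟩
  change IsCyclotomicExtension {n} ℚ ℚ⟮zetaC n⟯.toSubalgebra
  rw [adjoin_simple_toSubalgebra_of_isAlgebraic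
    (isIntegral_of_pow_eq_one hn (zetaC_pow n hn)).isAlgebraic]
  exact (isPrimitiveRoot_zetaC hn).adjoin_isCyclotomicExtension ℚ

lemma isGalois_of_le_realCyclo (hn : n ≠ 0) {E : IntermediateField ℚ ℂ} (hE : E ≤ realCyclo n) :
    IsGalois ℚ E := by
  have := isCyclotomicExtension_adjoin_zetaC hn
  have : IsAbelianGalois ℚ ℚ⟮zetaC n⟯ := IsCyclotomicExtension.isAbelianGalois {n} ℚ ℚ⟮zetaC n⟯
  have : IsAbelianGalois ℚ E := .of_algHom
    (inclusion (hE.trans (realCyclo_le_adjoin_zetaC n))).toRingHom.toRatAlgHom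
  infer_instance

lemma realCyclo_le_fieldRange_ofReal (hn : n ≠ 0) :
    realCyclo n ≤ (IsScalarTower.toAlgHom ℚ ℝ ℂ).fieldRange := by
  rw [realCyclo, adjoin_simple_le_iff]
  refine ⟨2 * (zetaC n).re, ?_⟩
  rw [Complex.inv_eq_conj (Complex.norm_eq_one_of_pow_eq_one (zetaC_pow n hn) hn),
    Complex.add_conj]
  simp

lemma isTotallyReal_of_le_realCyclo (hn : n ≠ 0) {E : IntermediateField ℚ ℂ}
    [FiniteDimensional ℚ E] (hE : E ≤ realCyclo n) : IsTotallyReal E := by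
  have hgal : IsGalois ℚ E := isGalois_of_le_realCyclo hn hE
  have hreal : InfinitePlace.IsReal (InfinitePlace.mk (algebraMap E ℂ)) := by
    rw [InfinitePlace.isReal_mk_iff, ComplexEmbedding.isReal_iff]
    ext x
    obtain ⟨r, hr⟩ := realCyclo_le_fieldRange_ofReal hn (hE x.2)
    change starRingEnd ℂ (x : ℂ) = x
    rw [← hr]
    exact Complex.conj_ofReal r
  refine ⟨fun w => ?_⟩
  obtain ⟨σ, rfl⟩ := InfinitePlace.exists_smul_eq_of_comap_eq (k := ℚ)
    (w := InfinitePlace.mk (algebraMap E ℂ)) (w' := w) (Subsingleton.elim _ _)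
  exact InfinitePlace.isReal_smul_iff.2 hreal

/-- Primes congruent to `1` modulo `n` split completely in subfields of `ℚ(ζ_n)`. -/
lemma absNorm_eq_of_natCast_eq_one (hn : n ≠ 0) {E : IntermediateField ℚ ℂ}
    [FiniteDimensional ℚ E] (hE : E ≤ ℚ⟮zetaC n⟯) {𝔓 : Ideal (𝓞 E)} (h𝔓 : 𝔓.IsPrime)
    {p : ℕ} (hp : p.Prime) (hp1 : (p : ZMod n) = 1) (hmem : (p : 𝓞 E) ∈ 𝔓) :
    Ideal.absNorm 𝔓 = p := by
  have : NeZero n := ⟨hn⟩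
  have : Fact p.Prime := ⟨hp⟩
  have hcyc := isCyclotomicExtension_adjoin_zetaC hn
  have : FiniteDimensional ℚ ℚ⟮zetaC n⟯ := IsCyclotomicExtension.finiteDimensional {n} ℚ _
  let : Algebra E ℚ⟮zetaC n⟯ := (inclusion hE).toRingHom.toAlgebra
  have hne : 𝔓 ≠ ⊥ := by
    rintro rfl
    exact hp.ne_zero (by exact_mod_cast (Ideal.mem_bot.1 hmem))
  have hmax : 𝔓.IsMaximal := h𝔓.isMaximal hne
  obtain ⟨𝔔, h𝔔max, h𝔔⟩ := Ideal.exists_maximal_ideal_liesOver_of_isIntegral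
    (S := 𝓞 ℚ⟮zetaC n⟯) 𝔓
  have hmem' : (p : 𝓞 ℚ⟮zetaC n⟯) ∈ 𝔔 := by
    rwa [h𝔔.over, Ideal.mem_comap, map_natCast] at hmem
  have : 𝔔.LiesOver (Ideal.span {(p : ℤ)}) := by
    refine ⟨(Int.ideal_span_isMaximal_of_prime p).eq_of_le (Ideal.IsPrime.under ℤ 𝔔).ne_top ?_⟩
    rw [Ideal.span_singleton_le_iff_mem, Ideal.mem_comap, map_natCast]
    exact hmem'
  have hndvd : ¬ p ∣ n := hp.coprime_iff_not_dvd.1 <|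
    (ZMod.isUnit_iff_coprime p n).1 (hp1 ▸ isUnit_one)
  have hN := Ideal.pow_inertiaDeg p 𝔔
  rw [IsCyclotomicExtension.Rat.inertiaDeg_eq_of_not_dvd (m := n) p ℚ⟮zetaC n⟯ 𝔔 hndvd, hp1,
    orderOf_one, pow_one] at hN
  rw [h𝔔.over, hN]
  exact absNorm_under_of_absNorm_prime (by rwa [← hN])

end Cyclotomic

lemma exists_algEquiv_apply_ne {K K' H : IntermediateField ℚ ℂ} [FiniteDimensional ℚ H]
    [IsGalois ℚ H] (hK : K ≤ H) (hK' : K' ≤ H) (h : ¬ K ≤ K') :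
    letI := (inclusion hK').toRingHom.toAlgebra
    ∃ σ : Gal(H/K'), ∃ x : K, σ (inclusion hK x) ≠ inclusion hK x := by
  let := (inclusion hK').toRingHom.toAlgebra
  have : IsScalarTower ℚ K' H := .of_algebraMap_eq fun _ => rfl
  have : IsGalois K' H := IsGalois.tower_top_of_isGalois ℚ K' H
  have : FiniteDimensional K' H := Module.Finite.of_restrictScalars_finite ℚ K' H
  by_contra! hfix
  refine h fun x hx => ?_
  obtain ⟨y, hy⟩ := mem_bot.1 <| (IsGalois.mem_bot_iff_fixed (inclusion hK ⟨x, hx⟩)).2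
    fun σ => hfix σ ⟨x, hx⟩
  have hyx : (y : ℂ) = x := congrArg Subtype.val hy
  exact hyx ▸ y.2

/-- The `p`-class numbers of two distinct real quadratic fields multiply to at most the `p`-class
number of a real cyclotomic field containing both, for odd `p`. -/
theorem pCard_mul_pCard_le_pCard_realCyclo {n : ℕ} (hn : n ≠ 0) {p : ℕ} (hp : p.Prime)
    (hodd : Odd p) {K K' : IntermediateField ℚ ℂ} [FiniteDimensional ℚ K]
    [FiniteDimensional ℚ K'] (hK : K ≤ realCyclo n) (hK' : K' ≤ realCyclo n)
    (h2 : finrank ℚ K = 2) (h2' : finrank ℚ K' = 2) (hne : K ≠ K') :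
    pCard (ClassGroup (𝓞 K)) p hp * pCard (ClassGroup (𝓞 K')) p hp ≤
      pCard (ClassGroup (𝓞 (realCyclo n))) p hp := by
  let : Algebra K (realCyclo n) := (inclusion hK).toRingHom.toAlgebra
  let : Algebra K' (realCyclo n) := (inclusion hK').toRingHom.toAlgebra
  have hG : IsGalois ℚ K := isGalois_of_le_realCyclo hn hK
  have hG' : IsGalois ℚ K' := isGalois_of_le_realCyclo hn hK'
  have := isTotallyReal_of_le_realCyclo hn hK
  have := isTotallyReal_of_le_realCyclo hn hK'
  have hH (𝔓 : Ideal (𝓞 (realCyclo n))) (h𝔓 : 𝔓.IsPrime) (r : ℕ) (hr : r.Prime)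
      (hr1 : (r : ZMod n) = 1) (hmem : (r : 𝓞 (realCyclo n)) ∈ 𝔓) : Ideal.absNorm 𝔓 = r :=
    absNorm_eq_of_natCast_eq_one hn (realCyclo_le_adjoin_zetaC n) h𝔓 hr hr1 hmem
  have := isGalois_of_le_realCyclo hn (le_refl (realCyclo n))
  obtain ⟨σ, hσ⟩ := exists_algEquiv_apply_ne hK hK' fun h =>
    hne (eq_of_le_of_finrank_eq h (h2.trans h2'.symm))
  obtain ⟨σ', hσ'⟩ := exists_algEquiv_apply_ne hK' hK fun h =>
    hne.symm (eq_of_le_of_finrank_eq h (h2'.trans h2.symm))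
  refine pCard_mul_pCard_le (k := 4) hp ?_
    ((classNorm (𝓞 K)).prod (classNorm (𝓞 K')))
    (pow_mem_range_prod_of_character _ _ fun ψ ψ' hψ => ⟨?_, ?_⟩)
  · intro h
    have h2 : p ∣ 2 := hp.dvd_of_dvd_pow (n := 2) h
    rw [(Nat.prime_dvd_prime_iff_eq hp Nat.prime_two).1 h2] at hodd
    exact absurd hodd (by decide)
  · exact MonoidHom.ext fun c => pow_four_eq_one_of_classNorm h2 hσ hn hH hψ c
  · exact MonoidHom.ext fun c => pow_four_eq_one_of_classNorm h2' hσ' hn hH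
      (fun c => by rw [mul_comm]; exact hψ c) c

/-- Theorem 1.4 of the paper. -/
theorem statement_2
    (n : ℕ) (hn : 0 < n)
    (ℓ : ℕ) (hℓ : ℓ.Prime) (hℓodd : Odd ℓ)
    (q : ℕ) (hq : q.Prime) (hqn : q ∣ n) (hqℓ : q ≡ 1 [MOD ℓ])
    (m : ℕ) (hm : 1 ≤ m)
    (K₂ : IntermediateField ℚ ℂ) [FiniteDimensional ℚ K₂]
    (hK₂H : K₂ ≤ realCyclo n) (hK₂deg : Module.finrank ℚ K₂ = 2)
    (hH : pCard (ClassGroup (𝓞 (realCyclo n))) ℓ hℓ = ℓ ^ m)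
    (hK₂cl : pCard (ClassGroup (𝓞 K₂)) ℓ hℓ = ℓ ^ (m - 1))
    (hker : ∀ (F K : IntermediateField ℚ ℂ) [FiniteDimensional ℚ F] [FiniteDimensional ℚ K]
      (hFK : F ≤ K), K ≤ realCyclo n → K₂ ≤ F →
      Module.finrank ℚ K = ℓ * Module.finrank ℚ F →
      pCard (ClassGroup (𝓞 F)) ℓ hℓ = ℓ ^ (m - 1) →
      pCard (ClassGroup (𝓞 K)) ℓ hℓ = ℓ ^ m →
      ∀ t : ClassGroup (𝓞 F) →* ClassGroup (𝓞 K), IsClassGroupExtHom hFK t →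
        (Subsingleton ↥(pPart ↥t.ker ℓ hℓ) ∨ ∃ r : ℕ, 0 < r ∧
          Nonempty (↥(pPart ↥t.ker ℓ hℓ) ≃* Multiplicative (Fin r → ZMod ℓ))))
    (K₂' : IntermediateField ℚ ℂ) [FiniteDimensional ℚ K₂']
    (hK₂'H : K₂' ≤ realCyclo n) (hK₂'deg : Module.finrank ℚ K₂' = 2)
    (hK₂'cl : ℓ ∣ NumberField.classNumber K₂')
    (i : ℕ) (hi : ℓ ^ i ∣ Module.finrank ℚ (realCyclo n))
    (hi' : ¬ ℓ ^ (i + 1) ∣ Module.finrank ℚ (realCyclo n))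
    (K' : IntermediateField ℚ ℂ) [FiniteDimensional ℚ K']
    (hK₂'K' : K₂' ≤ K') (hK'H : K' ≤ realCyclo n)
    (hK'deg : Module.finrank ℚ K' = ℓ ^ i * Module.finrank ℚ K₂')
    (hr₂ : pRank (ClassGroup (𝓞 K₂)) ℓ hℓ = 1)
    (hexc : ¬ (¬ IsCyclic ↥(pPart (ClassGroup (𝓞 (realCyclo n))) ℓ hℓ) ∧
      pCard (ClassGroup (𝓞 K')) ℓ hℓ = ℓ ^ m)) :
    pRank (ClassGroup (𝓞 K₂')) ℓ hℓ = 1 := by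
  by_cases hK : K₂ = K₂'
  · subst hK
    exact hr₂
  refine pRank_eq_one_of_pCard_eq (le_antisymm ?_ (Nat.le_of_dvd ?_ ?_))
  · have h := pCard_mul_pCard_le_pCard_realCyclo hn.ne' hℓ hℓodd hK₂H hK₂'H hK₂deg hK₂'deg hK
    rw [hK₂cl, hH, ← Nat.sub_add_cancel hm, Nat.add_sub_cancel, pow_succ] at h
    exact Nat.le_of_mul_le_mul_left h (pow_pos hℓ.pos _)
  · exact Nat.card_pos
  · refine dvd_pCard_of_dvd_card hℓ ?_
    rwa [NumberField.classNumber, ← Nat.card_eq_fintype_card] at hK₂'cl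

end PaperStmt
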